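/- There is a universal constant C > 0 with the following property. Let T > 0, let u⁰, f : [0,T] × 𝕋² → ℝ² be smooth and divergence-free in x for each t, and let g ∈ L²([0,T]) be such that ‖f(t)‖_{H^{0,1}} ≤ g(t) for all t ∈ [0,T]. Suppose X : [0,T] × 𝕋² → ℝ² is smooth, divergence-free in x for each t, satisfies X(0) = 0, and solves the forced linearized anisotropic Navier–Stokes equation along u⁰; i.e., for every smooth divergence-free φ : 𝕋² → ℝ² and every t ∈ [0,T], (d/dt) ∫_{𝕋²} X(t)·φ dx = − ∫_{𝕋²} ∂₁X(t)·∂₁φ dx − b(X(t), u⁰(t), φ) − b(u⁰(t), X(t), φ) + ∫_{𝕋²} f(t)·φ dx. Then sup_{t∈[0,T]} ‖X(t)‖²_{H^{0,1}} + ∫₀^T ‖X(t)‖²_{H^{1,1}} dt ≤ C ( ∫₀^T g(t)² dt ) · exp( C ∫₀^T (1 + ‖u⁰(t)‖²_{H^{1,2}}) dt ). -/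

import Mathlib

open MeasureTheory Real Complex Filter Set

noncomputable section

namespace Aniso

/-- Fundamental domain `(0, 2π]` for the circle of circumference `2π`. -/
def I2pi : Set ℝ := Set.Ioc 0 (2 * π)

/-- Fundamental domain for the 2-torus `𝕋² = (ℝ/2πℤ)²`. -/
def Q2 : Set (ℝ × ℝ) := I2pi ×ˢ I2pi

/-- Integral over the torus of a real function. -/
def tintR (f : ℝ × ℝ → ℝ) : ℝ := ∫ x in Q2, f x

/-- Smoothness of a scalar field. -/
def Smooth (f : ℝ × ℝ → ℝ) : Prop := ContDiff ℝ (⊤ : ℕ∞) f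

/-- Smoothness of a vector field. -/
def SmoothV (u : ℝ × ℝ → ℝ × ℝ) : Prop := ContDiff ℝ (⊤ : ℕ∞) u

/-- `2π`-periodicity in each variable: this encodes being a function on the torus. -/
def Per (f : ℝ × ℝ → ℝ) : Prop :=
  (∀ x : ℝ × ℝ, f (x.1 + 2 * π, x.2) = f x) ∧ (∀ x : ℝ × ℝ, f (x.1, x.2 + 2 * π) = f x)

def PerV (u : ℝ × ℝ → ℝ × ℝ) : Prop :=
  Per (fun x => (u x).1) ∧ Per (fun x => (u x).2)

/-- Partial derivative in the horizontal variable `x₁`. -/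
def pd1 (f : ℝ × ℝ → ℝ) : ℝ × ℝ → ℝ := fun x => fderiv ℝ f x (1, 0)

/-- Partial derivative in the vertical variable `x₂`. -/
def pd2 (f : ℝ × ℝ → ℝ) : ℝ × ℝ → ℝ := fun x => fderiv ℝ f x (0, 1)

def comp1 (u : ℝ × ℝ → ℝ × ℝ) : ℝ × ℝ → ℝ := fun x => (u x).1
def comp2 (u : ℝ × ℝ → ℝ × ℝ) : ℝ × ℝ → ℝ := fun x => (u x).2

def pd1V (u : ℝ × ℝ → ℝ × ℝ) : ℝ × ℝ → ℝ × ℝ := fun x => (pd1 (comp1 u) x, pd1 (comp2 u) x)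
def pd2V (u : ℝ × ℝ → ℝ × ℝ) : ℝ × ℝ → ℝ × ℝ := fun x => (pd2 (comp1 u) x, pd2 (comp2 u) x)

/-- Divergence-free condition `∂₁u¹ + ∂₂u² = 0`. -/
def DivFree (u : ℝ × ℝ → ℝ × ℝ) : Prop :=
  ∀ x, pd1 (comp1 u) x + pd2 (comp2 u) x = 0

/-- The transport term `u·∇v`, with components `u¹∂₁vʲ + u²∂₂vʲ`. -/
def advect (u v : ℝ × ℝ → ℝ × ℝ) : ℝ × ℝ → ℝ × ℝ := fun x =>
  ((u x).1 * pd1 (comp1 v) x + (u x).2 * pd2 (comp1 v) x,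
   (u x).1 * pd1 (comp2 v) x + (u x).2 * pd2 (comp2 v) x)

/-- L² inner product of real vector fields on the torus (summed over components). -/
def ipV (u v : ℝ × ℝ → ℝ × ℝ) : ℝ := tintR fun x => (u x).1 * (v x).1 + (u x).2 * (v x).2

/-- The trilinear form `b(u,v,w) = ∫ (u·∇v)·w`. -/
def b3 (u v w : ℝ × ℝ → ℝ × ℝ) : ℝ := ipV (advect u v) w

/-- L² norm of a scalar function on the torus. -/
def L2 (f : ℝ × ℝ → ℝ) : ℝ := Real.sqrt (tintR fun x => f x ^ 2)

/-- L² norm of a vector field on the torus. -/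
def L2V (u : ℝ × ℝ → ℝ × ℝ) : ℝ := Real.sqrt (tintR fun x => (u x).1 ^ 2 + (u x).2 ^ 2)

/-- Fourier coefficient of a complex-valued function on the torus. -/
def fcC (f : ℝ × ℝ → ℂ) (k : ℤ × ℤ) : ℂ :=
  (1 / (2 * π) ^ 2 : ℂ) *
    ∫ x in Q2, f x * Complex.exp (-(Complex.I) * ((k.1 : ℂ) * (x.1 : ℂ) + (k.2 : ℂ) * (x.2 : ℂ)))

/-- Fourier coefficient of a real-valued function on the torus. -/
def fc (f : ℝ × ℝ → ℝ) (k : ℤ × ℤ) : ℂ := fcC (fun x => (f x : ℂ)) k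

/-- Anisotropic Sobolev weight `(1+|k₁|²)^s (1+|k₂|²)^{s'}`. -/
def aw (s s' : ℝ) (k : ℤ × ℤ) : ℝ :=
  (1 + (k.1 : ℝ) ^ 2) ^ s * (1 + (k.2 : ℝ) ^ 2) ^ s'

/-- Square of the anisotropic Sobolev norm `H^{s,s'}` of a scalar function. -/
def HSq (s s' : ℝ) (f : ℝ × ℝ → ℝ) : ℝ := ∑' k : ℤ × ℤ, aw s s' k * ‖fc f k‖ ^ 2

/-- Anisotropic Sobolev norm `H^{s,s'}` of a scalar function. -/
def HN (s s' : ℝ) (f : ℝ × ℝ → ℝ) : ℝ := Real.sqrt (HSq s s' f)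

/-- Anisotropic Sobolev norm `H^{s,s'}` of a vector field. -/
def HNV (s s' : ℝ) (u : ℝ × ℝ → ℝ × ℝ) : ℝ :=
  Real.sqrt (HSq s s' (comp1 u) + HSq s s' (comp2 u))

/-- Mixed norm `L^∞_h(L²_v)`. -/
def LinfhL2v (f : ℝ × ℝ → ℝ) : ℝ :=
  essSup (fun x1 : ℝ => Real.sqrt (∫ x2 in I2pi, f (x1, x2) ^ 2)) (volume.restrict I2pi)

/-- Mixed norm `L²_h(L^∞_v)`. -/
def L2hLinfv (f : ℝ × ℝ → ℝ) : ℝ :=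
  Real.sqrt (∫ x1 in I2pi, (essSup (fun x2 : ℝ => |f (x1, x2)|) (volume.restrict I2pi)) ^ 2)

/-- Mixed norm `L²_v(L^{4/3}_h)`. -/
def L2vL43h {E : Type*} [NormedAddCommGroup E] (f : ℝ × ℝ → E) : ℝ :=
  Real.sqrt (∫ x2 in I2pi, (∫ x1 in I2pi, ‖f (x1, x2)‖ ^ ((4 : ℝ)/3)) ^ ((3 : ℝ)/2))

/-- Mixed norm `L^∞_v(L²_h)`. -/
def LinfvL2h {E : Type*} [NormedAddCommGroup E] (f : ℝ × ℝ → E) : ℝ :=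
  essSup (fun x2 : ℝ => Real.sqrt (∫ x1 in I2pi, ‖f (x1, x2)‖ ^ 2)) (volume.restrict I2pi)

/-- Mixed norm `L²_v(L⁴_h)`. -/
def L2vL4h {E : Type*} [NormedAddCommGroup E] (f : ℝ × ℝ → E) : ℝ :=
  Real.sqrt (∫ x2 in I2pi, Real.sqrt (∫ x1 in I2pi, ‖f (x1, x2)‖ ^ 4))

/-- One-dimensional Fourier coefficient on the circle of circumference `2π`. -/
def fc1 (g : ℝ → ℂ) (n : ℤ) : ℂ :=
  (1 / (2 * π) : ℂ) * ∫ x in I2pi, g x * Complex.exp (-(Complex.I) * ((n : ℂ) * (x : ℂ)))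

/-- Square of the 1-d Sobolev norm `H^s(𝕋)`. -/
def H1Sq (s : ℝ) (g : ℝ → ℂ) : ℝ := ∑' n : ℤ, (1 + (n : ℝ) ^ 2) ^ s * ‖fc1 g n‖ ^ 2

/-- Mixed norm `L²_v(H^s_h)`. -/
def L2vHsh (s : ℝ) (f : ℝ × ℝ → ℂ) : ℝ :=
  Real.sqrt (∫ x2 in I2pi, H1Sq s (fun x1 => f (x1, x2)))

/-- A dyadic partition of unity `(χ, θ)` on `ℝ`. -/
structure IsDyadicPartition (χ θ : ℝ → ℝ) : Prop where
  smooth_chi : ContDiff ℝ (⊤ : ℕ∞) χ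
  smooth_theta : ContDiff ℝ (⊤ : ℕ∞) θ
  nonneg_chi : ∀ z, 0 ≤ χ z
  nonneg_theta : ∀ z, 0 ≤ θ z
  even_chi : ∀ z, χ (-z) = χ z
  even_theta : ∀ z, θ (-z) = θ z
  chi_support : ∃ R > 0, ∀ z, R ≤ |z| → χ z = 0
  theta_support : ∃ r R : ℝ, 0 < r ∧ r < R ∧ ∀ z, (|z| < r ∨ R < |z|) → θ z = 0
  partition : ∀ z : ℝ, χ z + ∑' j : ℕ, θ ((2 : ℝ) ^ (-(j : ℤ)) * z) = 1
  chi_theta_disj : ∀ j : ℕ, 1 ≤ j → ∀ z, χ z * θ ((2 : ℝ) ^ (-(j : ℤ)) * z) = 0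
  theta_theta_disj : ∀ i j : ℕ, 1 < |(i : ℤ) - (j : ℤ)| → ∀ z,
    θ ((2 : ℝ) ^ (-(i : ℤ)) * z) * θ ((2 : ℝ) ^ (-(j : ℤ)) * z) = 0

/-- The Fourier multiplier symbol of the vertical Littlewood–Paley block `Δ^v_j`. -/
def blockSymb (χ θ : ℝ → ℝ) (j : ℤ) (z : ℝ) : ℝ :=
  if j = -1 then χ |z| else if 0 ≤ j then θ ((2 : ℝ) ^ (-j) * |z|) else 0

/-- The Fourier multiplier symbol of the vertical low-frequency cut-off `S^v_j`. -/
def lowSymb (χ θ : ℝ → ℝ) (j : ℤ) (z : ℝ) : ℝ :=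
  ∑ j' ∈ Finset.Icc (-1 : ℤ) (j - 2), blockSymb χ θ j' z

/-- The character `e^{ik·x}`. -/
def eK (k : ℤ × ℤ) (x : ℝ × ℝ) : ℂ :=
  Complex.exp (Complex.I * ((k.1 : ℂ) * (x.1 : ℂ) + (k.2 : ℂ) * (x.2 : ℂ)))

/-- Vertical Littlewood–Paley block `Δ^v_j` of a complex-valued function. -/
def LPC (χ θ : ℝ → ℝ) (j : ℤ) (f : ℝ × ℝ → ℂ) : ℝ × ℝ → ℂ :=
  fun x => ∑' k : ℤ × ℤ, (blockSymb χ θ j k.2 : ℂ) * fcC f k * eK k x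

/-- Vertical Littlewood–Paley block `Δ^v_j` of a real-valued function. -/
def LP (χ θ : ℝ → ℝ) (j : ℤ) (f : ℝ × ℝ → ℝ) : ℝ × ℝ → ℂ :=
  LPC χ θ j fun x => (f x : ℂ)

/-- Vertical low-frequency cut-off `S^v_j` of a complex-valued function. -/
def SvC (χ θ : ℝ → ℝ) (j : ℤ) (f : ℝ × ℝ → ℂ) : ℝ × ℝ → ℂ :=
  fun x => ∑' k : ℤ × ℤ, (lowSymb χ θ j k.2 : ℂ) * fcC f k * eK k x

/-- Vertical low-frequency cut-off `S^v_j` of a real-valued function. -/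
def Sv (χ θ : ℝ → ℝ) (j : ℤ) (f : ℝ × ℝ → ℝ) : ℝ × ℝ → ℂ :=
  SvC χ θ j fun x => (f x : ℂ)

/-- Componentwise Littlewood–Paley block of a vector field. -/
def LPV (χ θ : ℝ → ℝ) (j : ℤ) (u : ℝ × ℝ → ℝ × ℝ) : ℝ × ℝ → ℂ × ℂ :=
  fun x => (LP χ θ j (comp1 u) x, LP χ θ j (comp2 u) x)

/-- Componentwise low-frequency cut-off of a vector field. -/
def SvV (χ θ : ℝ → ℝ) (j : ℤ) (u : ℝ × ℝ → ℝ × ℝ) : ℝ × ℝ → ℂ × ℂ :=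
  fun x => (Sv χ θ j (comp1 u) x, Sv χ θ j (comp2 u) x)

/-- L² inner product of complex-valued functions on the torus. -/
def ipC (f g : ℝ × ℝ → ℂ) : ℂ := ∫ x in Q2, f x * (starRingEnd ℂ) (g x)

/-- L² inner product of complex vector fields on the torus (summed over components). -/
def ipCV (f g : ℝ × ℝ → ℂ × ℂ) : ℂ :=
  ∫ x in Q2, ((f x).1 * (starRingEnd ℂ) ((g x).1) + (f x).2 * (starRingEnd ℂ) ((g x).2))

/-- The vertical paraproduct `T^v_a g = Σ_j S^v_{j-1}a · Δ^v_j g`. -/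
def Tv (χ θ : ℝ → ℝ) (a g : ℝ × ℝ → ℝ) : ℝ × ℝ → ℂ :=
  fun x => ∑' j : ℤ, Sv χ θ (j - 1) a x * LP χ θ j g x

/-- The vertical remainder `R^v(a,g) = Σ_{|j-j'|≤1} Δ^v_j a · Δ^v_{j'} g`. -/
def Rv (χ θ : ℝ → ℝ) (a g : ℝ × ℝ → ℝ) : ℝ × ℝ → ℂ :=
  fun x => ∑' p : ℤ × ℤ, if |p.1 - p.2| ≤ 1 then LP χ θ p.1 a x * LP χ θ p.2 g x else 0


/-! ### Calculus of smooth periodic fields -/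

section Basics

variable {f g : ℝ × ℝ → ℝ}

lemma Smooth.differentiable (hf : Smooth f) : Differentiable ℝ f :=
  ContDiff.differentiable hf (by simp)

lemma Smooth.pd1 (hf : Smooth f) : Smooth (pd1 f) := by
  have h : ContDiff ℝ (⊤ : ℕ∞) (fderiv ℝ f) := ContDiff.fderiv_right hf (by simp)
  exact h.clm_apply contDiff_const

lemma Smooth.pd2 (hf : Smooth f) : Smooth (pd2 f) := by
  have h : ContDiff ℝ (⊤ : ℕ∞) (fderiv ℝ f) := ContDiff.fderiv_right hf (by simp)
  exact h.clm_apply contDiff_const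

lemma Smooth.mul (hf : Smooth f) (hg : Smooth g) : Smooth fun x => f x * g x :=
  ContDiff.mul hf hg

lemma Smooth.add (hf : Smooth f) (hg : Smooth g) : Smooth fun x => f x + g x :=
  ContDiff.add hf hg

lemma Smooth.sub (hf : Smooth f) (hg : Smooth g) : Smooth fun x => f x - g x :=
  ContDiff.sub hf hg

lemma pd2_add (hf : Smooth f) (hg : Smooth g) (x : ℝ × ℝ) :
    pd2 (fun x => f x + g x) x = pd2 f x + pd2 g x := by
  simp only [Aniso.pd2]
  rw [fderiv_fun_add (hf.differentiable x) (hg.differentiable x)]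
  rfl

lemma pd1_sub (hf : Smooth f) (hg : Smooth g) (x : ℝ × ℝ) :
    pd1 (fun x => f x - g x) x = pd1 f x - pd1 g x := by
  simp only [Aniso.pd1]
  rw [fderiv_fun_sub (hf.differentiable x) (hg.differentiable x)]
  rfl

lemma pd2_sub (hf : Smooth f) (hg : Smooth g) (x : ℝ × ℝ) :
    pd2 (fun x => f x - g x) x = pd2 f x - pd2 g x := by
  simp only [Aniso.pd2]
  rw [fderiv_fun_sub (hf.differentiable x) (hg.differentiable x)]
  rfl

lemma pd1_mul (hf : Smooth f) (hg : Smooth g) (x : ℝ × ℝ) :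
    pd1 (fun x => f x * g x) x = pd1 f x * g x + f x * pd1 g x := by
  simp only [Aniso.pd1]
  rw [fderiv_fun_mul (hf.differentiable x) (hg.differentiable x)]
  simp
  ring

lemma pd2_mul (hf : Smooth f) (hg : Smooth g) (x : ℝ × ℝ) :
    pd2 (fun x => f x * g x) x = pd2 f x * g x + f x * pd2 g x := by
  simp only [Aniso.pd2]
  rw [fderiv_fun_mul (hf.differentiable x) (hg.differentiable x)]
  simp
  ring

/-- Partial derivatives of a smooth function commute. -/
lemma pd1_pd2 (hf : Smooth f) : pd1 (pd2 f) = pd2 (pd1 f) := by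
  funext x
  have h : ContDiff ℝ (⊤ : ℕ∞) (fderiv ℝ f) := ContDiff.fderiv_right hf (by simp)
  have hd : DifferentiableAt ℝ (fderiv ℝ f) x := h.differentiable (by simp) x
  have hs : IsSymmSndFDerivAt ℝ f x := by
    apply ContDiffAt.isSymmSndFDerivAt (n := (⊤ : ℕ∞)) (ContDiff.contDiffAt hf)
    simp only [minSmoothness_of_isRCLikeNormedField]
    exact WithTop.coe_le_coe.2 le_top
  have e : ∀ v w : ℝ × ℝ, fderiv ℝ (fun y => fderiv ℝ f y v) x w
      = fderiv ℝ (fderiv ℝ f) x w v := by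
    intro v w
    rw [fderiv_clm_apply hd (differentiableAt_const v)]
    simp
  change fderiv ℝ (fun y => fderiv ℝ f y (0, 1)) x (1, 0)
    = fderiv ℝ (fun y => fderiv ℝ f y (1, 0)) x (0, 1)
  rw [e, e]
  exact hs.eq _ _

lemma fderiv_periodic {E : Type*} [NormedAddCommGroup E] [NormedSpace ℝ E] {f : ℝ × ℝ → E}
    {c : ℝ × ℝ} (h : ∀ x, f (x + c) = f x) (x : ℝ × ℝ) : fderiv ℝ f (x + c) = fderiv ℝ f x := by
  have : (fun y => f (y + c)) = f := funext h
  conv_rhs => rw [← this]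
  rw [fderiv_comp_add_right]

lemma Per.iff : Per f ↔ (∀ x, f (x + (2 * π, 0)) = f x) ∧ (∀ x, f (x + (0, 2 * π)) = f x) := by
  simp [Per]

lemma Per.pd1 (hf : Per f) : Per (pd1 f) := by
  rw [Per.iff] at hf ⊢
  exact ⟨fun x => by simp only [Aniso.pd1, fderiv_periodic hf.1],
    fun x => by simp only [Aniso.pd1, fderiv_periodic hf.2]⟩

lemma Per.pd2 (hf : Per f) : Per (pd2 f) := by
  rw [Per.iff] at hf ⊢
  exact ⟨fun x => by simp only [Aniso.pd2, fderiv_periodic hf.1],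
    fun x => by simp only [Aniso.pd2, fderiv_periodic hf.2]⟩

lemma Per.mul (hf : Per f) (hg : Per g) : Per fun x => f x * g x :=
  ⟨fun x => by simp only [hf.1, hg.1], fun x => by simp only [hf.2, hg.2]⟩

lemma Per.add (hf : Per f) (hg : Per g) : Per fun x => f x + g x :=
  ⟨fun x => by simp only [hf.1, hg.1], fun x => by simp only [hf.2, hg.2]⟩

lemma Per.sub (hf : Per f) (hg : Per g) : Per fun x => f x - g x :=
  ⟨fun x => by simp only [hf.1, hg.1], fun x => by simp only [hf.2, hg.2]⟩

end Basics

/-! ### Integration over the fundamental domain -/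

section Integration

variable {E : Type*} [NormedAddCommGroup E]

lemma two_pi_nonneg : (0 : ℝ) ≤ 2 * π := by positivity

lemma measurableSet_I2pi : MeasurableSet I2pi := measurableSet_Ioc

lemma measurableSet_Q2 : MeasurableSet Q2 := measurableSet_Ioc.prod measurableSet_Ioc

lemma Q2_subset : Q2 ⊆ Icc 0 (2 * π) ×ˢ Icc 0 (2 * π) :=
  Set.prod_mono Ioc_subset_Icc_self Ioc_subset_Icc_self

lemma isCompact_closedQ2 : IsCompact (Icc (0 : ℝ) (2 * π) ×ˢ Icc (0 : ℝ) (2 * π)) :=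
  isCompact_Icc.prod isCompact_Icc

lemma _root_.Continuous.integrableOn_Q2 {f : ℝ × ℝ → E} (hf : Continuous f) :
    IntegrableOn f Q2 :=
  (hf.continuousOn.integrableOn_compact isCompact_closedQ2).mono_set Q2_subset

lemma _root_.Continuous.integrableOn_I2pi {f : ℝ → E} (hf : Continuous f) :
    IntegrableOn f I2pi :=
  (hf.continuousOn.integrableOn_compact isCompact_Icc).mono_set Ioc_subset_Icc_self

variable [NormedSpace ℝ E]

lemma volume_I2pi : volume.real I2pi = 2 * π := by
  simp [I2pi, Measure.real, Real.pi_nonneg]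

lemma integral_Q2 {f : ℝ × ℝ → E} (hf : Continuous f) :
    ∫ x in Q2, f x = ∫ x1 in I2pi, ∫ x2 in I2pi, f (x1, x2) := by
  have := hf.integrableOn_Q2
  rw [Q2, Measure.volume_eq_prod] at *
  exact setIntegral_prod f this

lemma integral_Q2_swap {f : ℝ × ℝ → E} (hf : Continuous f) :
    ∫ x in Q2, f x = ∫ x2 in I2pi, ∫ x1 in I2pi, f (x1, x2) := by
  have h2 := integral_Q2 (f := fun x => f x.swap) (hf.comp continuous_swap)
  have h3 : ∫ x in Q2, f x.swap = ∫ x in Q2, f x := by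
    rw [Q2, Measure.volume_eq_prod]
    exact setIntegral_prod_swap I2pi I2pi f
  rw [← h3, h2]
  rfl

lemma integral_I2pi (f : ℝ → E) : ∫ x in I2pi, f x = ∫ x in (0 : ℝ)..(2 * π), f x :=
  (intervalIntegral.integral_of_le two_pi_nonneg).symm

variable [CompleteSpace E]

lemma integral_fderiv_fst {f : ℝ × ℝ → E} (hf : ContDiff ℝ 1 f)
    (hp : ∀ x : ℝ × ℝ, f (x.1 + 2 * π, x.2) = f x) : ∫ x in Q2, fderiv ℝ f x (1, 0) = 0 := by
  have hc : Continuous fun x => fderiv ℝ f x (1, 0) :=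
    (hf.continuous_fderiv (by simp)).clm_apply continuous_const
  rw [integral_Q2_swap hc]
  refine integral_eq_zero_of_ae (ae_of_all _ fun y => ?_)
  change ∫ x1 in I2pi, fderiv ℝ f (x1, y) (1, 0) = 0
  have hd : ∀ x ∈ uIcc 0 (2 * π), HasDerivAt (fun s => f (s, y)) (fderiv ℝ f (x, y) (1, 0)) x := by
    intro x _
    have := (hf.differentiable (by simp) (x, y)).hasFDerivAt
    exact this.comp_hasDerivAt x ((hasDerivAt_id x).prodMk (hasDerivAt_const x y))
  rw [integral_I2pi, intervalIntegral.integral_eq_sub_of_hasDerivAt hd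
    ((hc.comp (Continuous.prodMk_left y)).intervalIntegrable _ _)]
  have := hp (0, y)
  simp only [zero_add] at this
  simp [this]

lemma integral_fderiv_snd {f : ℝ × ℝ → E} (hf : ContDiff ℝ 1 f)
    (hp : ∀ x : ℝ × ℝ, f (x.1, x.2 + 2 * π) = f x) : ∫ x in Q2, fderiv ℝ f x (0, 1) = 0 := by
  have hc : Continuous fun x => fderiv ℝ f x (0, 1) :=
    (hf.continuous_fderiv (by simp)).clm_apply continuous_const
  rw [integral_Q2 hc]
  refine integral_eq_zero_of_ae (ae_of_all _ fun y => ?_)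
  change ∫ x2 in I2pi, fderiv ℝ f (y, x2) (0, 1) = 0
  have hd : ∀ x ∈ uIcc 0 (2 * π), HasDerivAt (fun s => f (y, s)) (fderiv ℝ f (y, x) (0, 1)) x := by
    intro x _
    have := (hf.differentiable (by simp) (y, x)).hasFDerivAt
    exact this.comp_hasDerivAt x ((hasDerivAt_const x y).prodMk (hasDerivAt_id x))
  rw [integral_I2pi, intervalIntegral.integral_eq_sub_of_hasDerivAt hd
    ((hc.comp (Continuous.prodMk_right y)).intervalIntegrable _ _)]
  have := hp (y, 0)
  simp only [zero_add] at this
  simp [this]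

end Integration

section TorusIntegral

variable {f g : ℝ × ℝ → ℝ}

lemma Smooth.continuous (hf : Smooth f) : Continuous f := ContDiff.continuous hf

lemma tintR_add (hf : Continuous f) (hg : Continuous g) :
    tintR (fun x => f x + g x) = tintR f + tintR g :=
  integral_add hf.integrableOn_Q2 hg.integrableOn_Q2

lemma tintR_sub (hf : Continuous f) (hg : Continuous g) :
    tintR (fun x => f x - g x) = tintR f - tintR g :=
  integral_sub hf.integrableOn_Q2 hg.integrableOn_Q2

lemma tintR_const_mul (c : ℝ) : tintR (fun x => c * f x) = c * tintR f :=
  integral_const_mul c f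

lemma tintR_nonneg (h : ∀ x, 0 ≤ f x) : 0 ≤ tintR f := integral_nonneg h

lemma tintR_mono (hf : Continuous f) (hg : Continuous g) (h : ∀ x, f x ≤ g x) :
    tintR f ≤ tintR g :=
  integral_mono hf.integrableOn_Q2 hg.integrableOn_Q2 h

lemma tintR_pd1 (hf : Smooth f) (hp : Per f) : tintR (pd1 f) = 0 :=
  integral_fderiv_fst (ContDiff.of_le hf (by simp)) hp.1

lemma tintR_pd2 (hf : Smooth f) (hp : Per f) : tintR (pd2 f) = 0 :=
  integral_fderiv_snd (ContDiff.of_le hf (by simp)) hp.2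

/-- Integration by parts in the vertical variable. -/
lemma tintR_mul_pd2 (hf : Smooth f) (hg : Smooth g) (hfp : Per f) (hgp : Per g) :
    tintR (fun x => f x * pd2 g x) = - tintR (fun x => pd2 f x * g x) := by
  have h := tintR_pd2 (hf.mul hg) (hfp.mul hgp)
  rw [funext (pd2_mul hf hg), tintR_add (hf.pd2.mul hg).continuous
    (hf.mul hg.pd2).continuous] at h
  linarith

end TorusIntegral

/-! ### Time-dependent fields -/

/-- Joint smoothness of a time-dependent scalar field. -/
def JointSmooth (F : ℝ → ℝ × ℝ → ℝ) : Prop :=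
  ContDiff ℝ (⊤ : ℕ∞) fun p : ℝ × (ℝ × ℝ) => F p.1 p.2

section Time

variable {F G : ℝ → ℝ × ℝ → ℝ}

lemma JointSmooth.fderiv_apply (hF : JointSmooth F) (v : ℝ × ℝ) :
    JointSmooth fun t x => fderiv ℝ (F t) x v := by
  have h : ContDiff ℝ (⊤ : ℕ∞)
      (Function.uncurry fun (p : ℝ × (ℝ × ℝ)) (y : ℝ × ℝ) => F p.1 y) :=
    ContDiff.comp (f := fun q : (ℝ × (ℝ × ℝ)) × (ℝ × ℝ) => (q.1.1, q.2)) hF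
      ((contDiff_fst.comp contDiff_fst).prodMk contDiff_snd)
  exact (ContDiff.fderiv h (contDiff_snd (E := ℝ)) (by simp)).clm_apply contDiff_const

lemma JointSmooth.pd1 (hF : JointSmooth F) : JointSmooth fun t => pd1 (F t) :=
  hF.fderiv_apply _

lemma JointSmooth.pd2 (hF : JointSmooth F) : JointSmooth fun t => pd2 (F t) :=
  hF.fderiv_apply _

lemma JointSmooth.mul (hF : JointSmooth F) (hG : JointSmooth G) :
    JointSmooth fun t x => F t x * G t x := ContDiff.mul hF hG

lemma JointSmooth.sub (hF : JointSmooth F) (hG : JointSmooth G) :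
    JointSmooth fun t x => F t x - G t x := ContDiff.sub hF hG

/-- Differentiation under the integral over the fundamental domain. -/
lemma differentiable_integral_Q2 {P : Type*} [NormedAddCommGroup P] [NormedSpace ℝ P]
    [ProperSpace P] {G : P × (ℝ × ℝ) → ℝ} (hG : ContDiff ℝ 1 G) :
    Differentiable ℝ fun p => ∫ x in Q2, G (p, x) := by
  intro p
  have hc : Continuous fun q : P × (ℝ × ℝ) =>
      (fderiv ℝ G q).comp (ContinuousLinearMap.inl ℝ P (ℝ × ℝ)) :=
    (hG.continuous_fderiv (by simp)).clm_comp continuous_const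
  obtain ⟨M, hM⟩ :=
    ((isCompact_closedBall p 1).prod isCompact_closedQ2).exists_bound_of_continuousOn
    hc.continuousOn
  refine (hasFDerivAt_integral_of_dominated_of_fderiv_le (s := Metric.closedBall p 1)
    (F' := fun p x => (fderiv ℝ G (p, x)).comp (ContinuousLinearMap.inl ℝ P (ℝ × ℝ)))
    (bound := fun _ => M) (Metric.closedBall_mem_nhds p one_pos) ?_ ?_ ?_ ?_ ?_ ?_).differentiableAt
  · exact Eventually.of_forall fun q =>
      (hG.continuous.comp (Continuous.prodMk_right q)).aestronglyMeasurable
  · exact (hG.continuous.comp (Continuous.prodMk_right p)).integrableOn_Q2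
  · exact (hc.comp (Continuous.prodMk_right p)).aestronglyMeasurable
  · filter_upwards [ae_restrict_mem measurableSet_Q2] with x hx q hq
    exact hM (q, x) ⟨hq, Q2_subset hx⟩
  · exact continuous_const.integrableOn_Q2
  · refine ae_of_all _ fun x q _ => ?_
    exact ((hG.differentiable (by simp) (q, x)).hasFDerivAt).comp q (hasFDerivAt_prodMk_left q x)

lemma JointSmooth.continuous_tintR (hF : JointSmooth F) : Continuous fun t => tintR (F t) :=
  (differentiable_integral_Q2 (G := fun p : ℝ × (ℝ × ℝ) => F p.1 p.2)
    (ContDiff.of_le hF (by simp))).continuous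

/-- The pairing of two smooth time-dependent fields at two different times. -/
lemma JointSmooth.differentiable_pairing (hF : JointSmooth F) (hG : JointSmooth G) :
    Differentiable ℝ fun p : ℝ × ℝ => tintR fun x => F p.1 x * G p.2 x := by
  refine differentiable_integral_Q2
    (G := fun q : (ℝ × ℝ) × (ℝ × ℝ) => F q.1.1 q.2 * G q.1.2 q.2) ?_
  refine ContDiff.of_le (n := ((⊤ : ℕ∞) : WithTop ℕ∞)) (ContDiff.mul ?_ ?_) (by simp)
  · exact ContDiff.comp (f := fun q : (ℝ × ℝ) × (ℝ × ℝ) => (q.1.1, q.2)) hF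
      ((contDiff_fst.comp contDiff_fst).prodMk contDiff_snd)
  · exact ContDiff.comp (f := fun q : (ℝ × ℝ) × (ℝ × ℝ) => (q.1.2, q.2)) hG
      ((contDiff_snd.comp contDiff_fst).prodMk contDiff_snd)

/-- The derivative of a symmetric function of two variables along the diagonal. -/
lemma hasDerivAt_diagonal {B : ℝ × ℝ → ℝ} (hd : Differentiable ℝ B)
    (hs : ∀ s t, B (s, t) = B (t, s)) {t b : ℝ} (h : HasDerivAt (fun s => B (s, t)) b t) :
    HasDerivAt (fun s => B (s, s)) (2 * b) t := by
  have hB := (hd (t, t)).hasFDerivAt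
  have h1 := HasFDerivAt.comp_hasDerivAt (f := fun s : ℝ => (s, t)) t hB
    ((hasDerivAt_id t).prodMk (hasDerivAt_const t t))
  have h2 := HasFDerivAt.comp_hasDerivAt (f := fun s : ℝ => (t, s)) t hB
    ((hasDerivAt_const t t).prodMk (hasDerivAt_id t))
  have h3 := HasFDerivAt.comp_hasDerivAt (f := fun s : ℝ => (s, s)) t hB
    ((hasDerivAt_id t).prodMk (hasDerivAt_id t))
  have e1 := h1.unique h
  have h' : HasDerivAt (fun s => B (t, s)) b t := by simpa only [hs t] using h
  have e2 := h2.unique h'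
  have e3 : fderiv ℝ B (t, t) (1, 1) = 2 * b := by
    have : ((1 : ℝ), (1 : ℝ)) = (1, 0) + (0, 1) := by simp
    rw [this, map_add, e1, e2, two_mul]
  exact e3 ▸ h3

end Time

/-! ### An anisotropic product estimate -/

section Product

/-- Square of the `L²` norm. -/
def normSq (f : ℝ × ℝ → ℝ) : ℝ := tintR fun x => f x ^ 2

variable {f g a h k : ℝ × ℝ → ℝ}

lemma normSq_nonneg (f : ℝ × ℝ → ℝ) : 0 ≤ normSq f := tintR_nonneg fun _ => sq_nonneg _

/-- The Cauchy–Schwarz inequality on the torus. -/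
lemma tintR_mul_sq_le (hf : Continuous f) (hg : Continuous g) :
    tintR (fun x => f x * g x) ^ 2 ≤ normSq f * normSq g := by
  have h : ∀ s : ℝ, 0 ≤ normSq g * (s * s) + 2 * tintR (fun x => f x * g x) * s + normSq f := by
    intro s
    have e : tintR (fun x => (f x + s * g x) ^ 2)
        = normSq g * (s * s) + 2 * tintR (fun x => f x * g x) * s + normSq f := by
      have : (fun x => (f x + s * g x) ^ 2)
          = fun x => (f x ^ 2 + (2 * s) * (f x * g x)) + (s * s) * (g x ^ 2) := by
        funext x; ring
      rw [this, tintR_add (by fun_prop) (by fun_prop), tintR_add (by fun_prop) (by fun_prop),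
        tintR_const_mul, tintR_const_mul, normSq, normSq]
      ring
    rw [← e]
    exact tintR_nonneg fun _ => sq_nonneg _
  have := discrim_le_zero h
  rw [discrim] at this
  linarith

/-- Agmon-type bound on an interval of length `2π`. -/
lemma sq_le_integral_I2pi {p p' : ℝ → ℝ} (hp : ∀ x, HasDerivAt p (p' x) x) (hp' : Continuous p')
    {y : ℝ} (hy : y ∈ I2pi) : p y ^ 2 ≤ 2 * ∫ z in I2pi, (p z ^ 2 + p' z ^ 2) := by
  have hc : Continuous p := continuous_iff_continuousAt.2 fun x => (hp x).continuousAt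
  set S := ∫ z in I2pi, (p z ^ 2 + p' z ^ 2) with hS
  have hint : IntegrableOn (fun z => p z ^ 2 + p' z ^ 2) I2pi :=
    Continuous.integrableOn_I2pi (by fun_prop)
  have hS0 : 0 ≤ S := integral_nonneg fun z => by positivity
  have key : ∀ z ∈ I2pi, p y ^ 2 ≤ p z ^ 2 + S := by
    intro z hz
    have hd : ∀ x ∈ uIcc z y, HasDerivAt (fun x => p x ^ 2) (2 * p x * p' x) x := by
      intro x _
      simpa using (hp x).fun_pow 2
    have e := intervalIntegral.integral_eq_sub_of_hasDerivAt hd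
      (Continuous.intervalIntegrable (by fun_prop) _ _)
    have hsub : Set.uIoc z y ⊆ I2pi := by
      intro x hx
      rcases Set.mem_uIoc.1 hx with hx | hx
      · exact ⟨hz.1.trans hx.1, hx.2.trans hy.2⟩
      · exact ⟨hy.1.trans hx.1, hx.2.trans hz.2⟩
    have b1 : ‖∫ x in z..y, 2 * p x * p' x‖ ≤ ∫ x in Set.uIoc z y, ‖2 * p x * p' x‖ :=
      intervalIntegral.norm_integral_le_integral_norm_uIoc
    have b2 : ∫ x in Set.uIoc z y, ‖2 * p x * p' x‖ ≤
        ∫ x in Set.uIoc z y, (p x ^ 2 + p' x ^ 2) := by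
      refine integral_mono_of_nonneg (ae_of_all _ fun x => norm_nonneg _) (hint.mono_set hsub)
        (ae_of_all _ fun x => ?_)
      simp only [Real.norm_eq_abs]
      rw [abs_le]
      constructor <;> nlinarith [sq_nonneg (p x - p' x), sq_nonneg (p x + p' x)]
    have b3 : ∫ x in Set.uIoc z y, (p x ^ 2 + p' x ^ 2) ≤ S :=
      setIntegral_mono_set hint (ae_of_all _ fun x => by positivity) hsub.eventuallyLE
    have := (Real.le_norm_self _).trans (b1.trans (b2.trans b3))
    rw [e] at this
    linarith
  have hconst : ∀ c : ℝ, ∫ _ in I2pi, c = 2 * π * c := by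
    intro c
    rw [setIntegral_const, volume_I2pi, smul_eq_mul]
  have hI : ∫ z in I2pi, p y ^ 2 ≤ ∫ z in I2pi, (p z ^ 2 + S) :=
    setIntegral_mono_on continuous_const.integrableOn_I2pi
      (Continuous.integrableOn_I2pi (by fun_prop)) measurableSet_I2pi key
  rw [integral_add (Continuous.integrableOn_I2pi (by fun_prop)) continuous_const.integrableOn_I2pi,
    hconst, hconst] at hI
  have hle : ∫ z in I2pi, p z ^ 2 ≤ S :=
    integral_mono (Continuous.integrableOn_I2pi (by fun_prop)) hint
      fun z => by simp only [le_add_iff_nonneg_right]; positivity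
  nlinarith [Real.pi_gt_three]

lemma hasDerivAt_slice_fst (hf : Smooth f) (y x : ℝ) :
    HasDerivAt (fun s => f (s, y)) (pd1 f (x, y)) x :=
  ((hf.differentiable (x, y)).hasFDerivAt).comp_hasDerivAt x
    ((hasDerivAt_id x).prodMk (hasDerivAt_const x y))

lemma hasDerivAt_slice_snd (hf : Smooth f) (y x : ℝ) :
    HasDerivAt (fun s => f (y, s)) (pd2 f (y, x)) x :=
  ((hf.differentiable (y, x)).hasFDerivAt).comp_hasDerivAt x
    ((hasDerivAt_const x y).prodMk (hasDerivAt_id x))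

lemma _root_.Continuous.integrable_slice_fst (hf : Continuous f) :
    IntegrableOn (fun x1 => ∫ x2 in I2pi, f (x1, x2)) I2pi := by
  have := hf.integrableOn_Q2
  rw [IntegrableOn, Q2, Measure.volume_eq_prod, ← Measure.prod_restrict] at this
  exact this.integral_prod_left

lemma _root_.Continuous.integrable_slice_snd (hf : Continuous f) :
    IntegrableOn (fun x2 => ∫ x1 in I2pi, f (x1, x2)) I2pi := by
  have := hf.integrableOn_Q2
  rw [IntegrableOn, Q2, Measure.volume_eq_prod, ← Measure.prod_restrict] at this
  exact this.integral_prod_right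

lemma normSq_add_normSq (hf : Continuous f) (hg : Continuous g) :
    normSq f + normSq g = tintR fun x => f x ^ 2 + g x ^ 2 :=
  (tintR_add (hf.pow 2) (hg.pow 2)).symm

/-- `H^{0,1}` embeds into `L^∞_v L²_h`. -/
lemma integral_slice_sq_le (ha : Smooth a) {y : ℝ} (hy : y ∈ I2pi) :
    ∫ x in I2pi, a (x, y) ^ 2 ≤ 2 * (normSq a + normSq (pd2 a)) := by
  have hc := ha.continuous
  have hc2 := ha.pd2.continuous
  rw [normSq_add_normSq hc hc2, tintR, integral_Q2 (by fun_prop), ← integral_const_mul]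
  refine integral_mono (Continuous.integrableOn_I2pi (by fun_prop))
    ((Continuous.integrable_slice_fst
      (f := fun x => a x ^ 2 + pd2 a x ^ 2) (by fun_prop)).const_mul 2) fun x => ?_
  exact sq_le_integral_I2pi (fun s => hasDerivAt_slice_snd ha x s) (by fun_prop) hy

/-- The product of an `H^{0,1}` and an `H^{1,0}` function is square integrable. -/
lemma normSq_mul_le (ha : Smooth a) (hh : Smooth h) :
    normSq (fun x => a x * h x) ≤
      4 * (normSq a + normSq (pd2 a)) * (normSq h + normSq (pd1 h)) := by
  have hc := ha.continuous
  have hhc := hh.continuous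
  have hhc1 := hh.pd1.continuous
  rw [normSq_add_normSq hhc hhc1, normSq, tintR, tintR, integral_Q2_swap (by fun_prop),
    integral_Q2_swap (by fun_prop), ← integral_const_mul]
  refine setIntegral_mono_on (Continuous.integrable_slice_snd
      (f := fun x => (a x * h x) ^ 2) (by fun_prop))
    ((Continuous.integrable_slice_snd (f := fun x => h x ^ 2 + pd1 h x ^ 2)
      (by fun_prop)).const_mul _) measurableSet_I2pi fun y hy => ?_
  set H := ∫ x in I2pi, (h (x, y) ^ 2 + pd1 h (x, y) ^ 2) with hH
  have hH0 : 0 ≤ H := integral_nonneg fun z => by positivity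
  have h1 : ∫ x in I2pi, (a (x, y) * h (x, y)) ^ 2 ≤ ∫ x in I2pi, (2 * H) * a (x, y) ^ 2 := by
    refine setIntegral_mono_on (Continuous.integrableOn_I2pi (by fun_prop))
      (Continuous.integrableOn_I2pi (by fun_prop)) measurableSet_I2pi fun x hx => ?_
    have := sq_le_integral_I2pi (fun s => hasDerivAt_slice_fst hh y s) (by fun_prop) hx
    rw [mul_pow, mul_comm]
    exact mul_le_mul_of_nonneg_right this (sq_nonneg _)
  rw [integral_const_mul] at h1
  have h2 := integral_slice_sq_le ha hy
  nlinarith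

/-- Trilinear estimate with one factor in `H^{0,1}`, one in `H^{1,0}` and one in `L²`. -/
lemma tintR_mul_mul_sq_le (ha : Smooth a) (hh : Smooth h) (hk : Smooth k) :
    tintR (fun x => a x * h x * k x) ^ 2 ≤
      4 * ((normSq a + normSq (pd2 a)) * (normSq h + normSq (pd1 h)) * normSq k) := by
  have h1 := tintR_mul_sq_le (ha.mul hh).continuous hk.continuous
  have h2 := normSq_mul_le ha hh
  nlinarith [normSq_nonneg k]

/-- Absorption of a trilinear term. -/
lemma abs_tintR_mul_mul_le (ha : Smooth a) (hh : Smooth h) (hk : Smooth k) {U M N ε : ℝ}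
    (hε : 0 < ε) (hU : 0 ≤ U) (hM : 0 ≤ M) (hN : 0 ≤ N)
    (hb : (normSq a + normSq (pd2 a)) * (normSq h + normSq (pd1 h)) * normSq k ≤ U * M * N) :
    |tintR (fun x => a x * h x * k x)| ≤ ε * N + U * M / ε := by
  have h1 := tintR_mul_mul_sq_le ha hh hk
  refine abs_le_of_sq_le_sq ?_ (by positivity)
  have h2 : (ε * N + U * M / ε) ^ 2 = (ε * N - U * M / ε) ^ 2 + 4 * (U * M * N) := by
    field_simp
    ring
  nlinarith [sq_nonneg (ε * N - U * M / ε)]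

end Product

/-! ### Parseval's identity on the torus -/

section Parseval

lemma hasSum_sq_fc1 {g : ℝ → ℂ} (hg : Continuous g) :
    HasSum (fun n => ‖fc1 g n‖ ^ 2) ((2 * π)⁻¹ * ∫ x in I2pi, ‖g x‖ ^ 2) := by
  have hab : (0 : ℝ) < 2 * π := by positivity
  have hL : MemLp g 2 (volume.restrict (Ioc 0 (2 * π))) := by
    obtain ⟨M, hM⟩ := (isCompact_Icc (a := (0 : ℝ)) (b := 2 * π)).exists_bound_of_continuousOn
      hg.continuousOn
    refine MemLp.of_bound hg.aestronglyMeasurable M ?_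
    filter_upwards [ae_restrict_mem measurableSet_Ioc] with x hx
    exact hM x (Ioc_subset_Icc_self hx)
  have h := hasSum_sq_fourierCoeffOn hab hL
  have e : ∀ n, fourierCoeffOn hab g n = fc1 g n := by
    intro n
    rw [fourierCoeffOn_eq_integral, fc1, integral_I2pi, Complex.real_smul]
    congr 1
    · push_cast; ring
    · refine intervalIntegral.integral_congr fun x _ => ?_
      simp only [smul_eq_mul]
      rw [fourier_coe_apply, mul_comm]
      congr 2
      push_cast
      have : (π : ℂ) ≠ 0 := by exact_mod_cast Real.pi_ne_zero
      field_simp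
      ring
  simp only [e, sub_zero, smul_eq_mul, ← integral_I2pi] at h
  exact h

variable {f : ℝ × ℝ → ℂ}

lemma continuous_fc1_slice (hf : Continuous f) (m : ℤ) :
    Continuous fun y => fc1 (fun x => f (x, y)) m := by
  unfold fc1
  simp_rw [integral_I2pi]
  refine continuous_const.mul
    (intervalIntegral.continuous_parametric_intervalIntegral_of_continuous' ?_ _ _)
  simp only [Function.uncurry_def]
  fun_prop

lemma fcC_eq_fc1 (hf : Continuous f) (k : ℤ × ℤ) :
    fcC f k = fc1 (fun y => fc1 (fun x => f (x, y)) k.1) k.2 := by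
  rw [fcC, integral_Q2_swap (by fun_prop), fc1]
  have : ∀ y : ℝ, fc1 (fun x => f (x, y)) k.1 * Complex.exp (-(Complex.I) * ((k.2 : ℂ) * (y : ℂ)))
      = (1 / (2 * π) : ℂ) * ∫ x in I2pi, f (x, y) *
        Complex.exp (-(Complex.I) * ((k.1 : ℂ) * (x : ℂ) + (k.2 : ℂ) * (y : ℂ))) := by
    intro y
    rw [fc1, mul_assoc, ← integral_mul_const]
    congr 2
    funext x
    rw [mul_add, Complex.exp_add]
    ring
  simp_rw [this]
  rw [integral_const_mul]
  ring

/-- Parseval's identity on the torus. -/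
lemma hasSum_sq_fcC (hf : Continuous f) :
    HasSum (fun k => ‖fcC f k‖ ^ 2) ((2 * π)⁻¹ ^ 2 * ∫ x in Q2, ‖f x‖ ^ 2) := by
  have hslice : ∀ y : ℝ, HasSum (fun m => ‖fc1 (fun x => f (x, y)) m‖ ^ 2)
      ((2 * π)⁻¹ * ∫ x in I2pi, ‖f (x, y)‖ ^ 2) :=
    fun y => hasSum_sq_fc1 (g := fun x => f (x, y)) (by fun_prop)
  have hinner : ∀ m : ℤ, HasSum (fun n => ‖fcC f (m, n)‖ ^ 2)
      ((2 * π)⁻¹ * ∫ y in I2pi, ‖fc1 (fun x => f (x, y)) m‖ ^ 2) := by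
    intro m
    simp_rw [fcC_eq_fc1 hf]
    exact hasSum_sq_fc1 (continuous_fc1_slice hf m)
  have hint : IntegrableOn (fun y => (2 * π)⁻¹ * ∫ x in I2pi, ‖f (x, y)‖ ^ 2) I2pi :=
    (Continuous.integrable_slice_snd (f := fun x => ‖f x‖ ^ 2) (by fun_prop)).const_mul _
  have hswap : HasSum (fun m => ∫ y in I2pi, ‖fc1 (fun x => f (x, y)) m‖ ^ 2)
      (∫ y in I2pi, (2 * π)⁻¹ * ∫ x in I2pi, ‖f (x, y)‖ ^ 2) := by
    refine hasSum_integral_of_dominated_convergence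
      (fun m y => ‖fc1 (fun x => f (x, y)) m‖ ^ 2) ?_ ?_ ?_ ?_ ?_
    · exact fun m => ((continuous_fc1_slice hf m).norm.pow 2).aestronglyMeasurable
    · exact fun m => ae_of_all _ fun y => by simp
    · exact ae_of_all _ fun y => (hslice y).summable
    · simp_rw [fun y => (hslice y).tsum_eq]
      exact hint
    · exact ae_of_all _ hslice
  have hswap' := hswap.mul_left (2 * π)⁻¹
  have hs : Summable fun k : ℤ × ℤ => ‖fcC f k‖ ^ 2 := by
    rw [summable_prod_of_nonneg fun k => by positivity]
    refine ⟨fun m => (hinner m).summable, ?_⟩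
    simp_rw [fun m => (hinner m).tsum_eq]
    exact hswap'.summable
  have h := hs.hasSum.prod_fiberwise hinner
  have e := h.unique hswap'
  have e2 : (2 * π)⁻¹ * ∫ y in I2pi, (2 * π)⁻¹ * ∫ x in I2pi, ‖f (x, y)‖ ^ 2
      = (2 * π)⁻¹ ^ 2 * ∫ x in Q2, ‖f x‖ ^ 2 := by
    rw [integral_const_mul, integral_Q2_swap (by fun_prop)]
    ring
  rw [← e2, ← e]
  exact hs.hasSum

end Parseval

section SobolevNorms

variable {f : ℝ × ℝ → ℝ}

lemma hasSum_sq_fc (hf : Continuous f) :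
    HasSum (fun k => ‖fc f k‖ ^ 2) ((2 * π)⁻¹ ^ 2 * normSq f) := by
  have := hasSum_sq_fcC (f := fun x => (f x : ℂ)) (by fun_prop)
  simpa [fc, normSq, tintR] using this

lemma hasFDerivAt_character (k : ℤ × ℤ) (x : ℝ × ℝ) :
    HasFDerivAt (fun x : ℝ × ℝ =>
        Complex.exp (-(Complex.I) * ((k.1 : ℂ) * (x.1 : ℂ) + (k.2 : ℂ) * (x.2 : ℂ))))
      (Complex.exp (-(Complex.I) * ((k.1 : ℂ) * (x.1 : ℂ) + (k.2 : ℂ) * (x.2 : ℂ))) •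
        (-(Complex.I)) • ((k.1 : ℂ) • Complex.ofRealCLM.comp (ContinuousLinearMap.fst ℝ ℝ ℝ)
          + (k.2 : ℂ) • Complex.ofRealCLM.comp (ContinuousLinearMap.snd ℝ ℝ ℝ))) x := by
  refine HasFDerivAt.cexp (HasFDerivAt.const_mul (HasFDerivAt.add
    (HasFDerivAt.const_mul ?_ _) (HasFDerivAt.const_mul ?_ _)) _)
  · exact (Complex.ofRealCLM.comp (ContinuousLinearMap.fst ℝ ℝ ℝ)).hasFDerivAt
  · exact (Complex.ofRealCLM.comp (ContinuousLinearMap.snd ℝ ℝ ℝ)).hasFDerivAt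

lemma contDiff_mul_character (hf : Smooth f) (k : ℤ × ℤ) :
    ContDiff ℝ 1 fun x : ℝ × ℝ => (f x : ℂ) *
      Complex.exp (-(Complex.I) * ((k.1 : ℂ) * (x.1 : ℂ) + (k.2 : ℂ) * (x.2 : ℂ))) := by
  have h0 : ContDiff ℝ 1 f := ContDiff.of_le hf (by simp)
  have h1 : ContDiff ℝ 1 fun x : ℝ × ℝ => (x.1 : ℂ) :=
    Complex.ofRealCLM.contDiff.comp contDiff_fst
  have h2 : ContDiff ℝ 1 fun x : ℝ × ℝ => (x.2 : ℂ) :=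
    Complex.ofRealCLM.contDiff.comp contDiff_snd
  exact (Complex.ofRealCLM.contDiff.comp h0).mul
    (contDiff_const.mul ((contDiff_const.mul h1).add (contDiff_const.mul h2))).cexp

lemma fderiv_mul_character (hf : Smooth f) (k : ℤ × ℤ) (x v : ℝ × ℝ) :
    fderiv ℝ (fun x : ℝ × ℝ => (f x : ℂ) *
      Complex.exp (-(Complex.I) * ((k.1 : ℂ) * (x.1 : ℂ) + (k.2 : ℂ) * (x.2 : ℂ)))) x v =
    (fderiv ℝ f x v : ℂ) *
      Complex.exp (-(Complex.I) * ((k.1 : ℂ) * (x.1 : ℂ) + (k.2 : ℂ) * (x.2 : ℂ))) -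
    (Complex.I * (k.1 * v.1 + k.2 * v.2)) * ((f x : ℂ) *
      Complex.exp (-(Complex.I) * ((k.1 : ℂ) * (x.1 : ℂ) + (k.2 : ℂ) * (x.2 : ℂ)))) := by
  have h1 : HasFDerivAt (fun x => (f x : ℂ)) (Complex.ofRealCLM.comp (fderiv ℝ f x)) x :=
    Complex.ofRealCLM.hasFDerivAt.comp x (hf.differentiable x).hasFDerivAt
  rw [(h1.fun_mul (hasFDerivAt_character k x)).fderiv]
  simp
  ring

lemma exp_character_add_period (c : ℂ) (n : ℤ) :
    Complex.exp (-(Complex.I) * (c + n * (2 * π))) = Complex.exp (-(Complex.I) * c) := by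
  have : -(Complex.I) * (c + n * (2 * π)) = -(Complex.I) * c + (-n : ℤ) * (2 * π * Complex.I) := by
    push_cast; ring
  rw [this, Complex.exp_add, Complex.exp_int_mul_two_pi_mul_I, mul_one]

lemma fc_pd1 (hf : Smooth f) (hp : Per f) (k : ℤ × ℤ) :
    fc (pd1 f) k = Complex.I * k.1 * fc f k := by
  have h := integral_fderiv_fst (contDiff_mul_character hf k) fun x => by
    simp only [hp.1 x]
    congr 1
    rw [← exp_character_add_period ((k.1 : ℂ) * (x.1 : ℂ) + (k.2 : ℂ) * (x.2 : ℂ)) k.1]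
    congr 1
    push_cast
    ring
  simp_rw [fderiv_mul_character hf] at h
  have hc := hf.continuous
  have hc' := hf.pd1.continuous
  have e : ∀ x, fderiv ℝ f x (1, 0) = pd1 f x := fun _ => rfl
  simp_rw [e] at h
  rw [integral_sub (Continuous.integrableOn_Q2 (by fun_prop))
    (Continuous.integrableOn_Q2 (by fun_prop)), integral_const_mul] at h
  rw [fc, fcC, fc, fcC, sub_eq_zero.1 h]
  push_cast
  ring

lemma fc_pd2 (hf : Smooth f) (hp : Per f) (k : ℤ × ℤ) :
    fc (pd2 f) k = Complex.I * k.2 * fc f k := by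
  have h := integral_fderiv_snd (contDiff_mul_character hf k) fun x => by
    simp only [hp.2 x]
    congr 1
    rw [← exp_character_add_period ((k.1 : ℂ) * (x.1 : ℂ) + (k.2 : ℂ) * (x.2 : ℂ)) k.2]
    congr 1
    push_cast
    ring
  simp_rw [fderiv_mul_character hf] at h
  have hc := hf.continuous
  have hc' := hf.pd2.continuous
  have e : ∀ x, fderiv ℝ f x (0, 1) = pd2 f x := fun _ => rfl
  simp_rw [e] at h
  rw [integral_sub (Continuous.integrableOn_Q2 (by fun_prop))
    (Continuous.integrableOn_Q2 (by fun_prop)), integral_const_mul] at h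
  rw [fc, fcC, fc, fcC, sub_eq_zero.1 h]
  push_cast
  ring

lemma norm_fc_pd1_sq (hf : Smooth f) (hp : Per f) (k : ℤ × ℤ) :
    ‖fc (pd1 f) k‖ ^ 2 = (k.1 : ℝ) ^ 2 * ‖fc f k‖ ^ 2 := by
  rw [fc_pd1 hf hp]
  simp [mul_pow]

lemma norm_fc_pd2_sq (hf : Smooth f) (hp : Per f) (k : ℤ × ℤ) :
    ‖fc (pd2 f) k‖ ^ 2 = (k.2 : ℝ) ^ 2 * ‖fc f k‖ ^ 2 := by
  rw [fc_pd2 hf hp]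
  simp [mul_pow]

lemma HSq_zero_one (hf : Smooth f) (hp : Per f) :
    HSq 0 1 f = (2 * π)⁻¹ ^ 2 * (normSq f + normSq (pd2 f)) := by
  rw [mul_add]
  refine HasSum.tsum_eq ?_
  convert (hasSum_sq_fc hf.continuous).add (hasSum_sq_fc hf.pd2.continuous) using 2 with k
  rw [norm_fc_pd2_sq hf hp, aw, Real.rpow_zero, Real.rpow_one]
  ring

lemma HSq_one_one (hf : Smooth f) (hp : Per f) :
    HSq 1 1 f = (2 * π)⁻¹ ^ 2 *
      (normSq f + normSq (pd2 f) + (normSq (pd1 f) + normSq (pd2 (pd1 f)))) := by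
  rw [mul_add, mul_add, mul_add]
  refine HasSum.tsum_eq ?_
  convert ((hasSum_sq_fc hf.continuous).add (hasSum_sq_fc hf.pd2.continuous)).add
    ((hasSum_sq_fc hf.pd1.continuous).add (hasSum_sq_fc hf.pd1.pd2.continuous)) using 2 with k
  rw [norm_fc_pd2_sq hf hp, norm_fc_pd2_sq hf.pd1 hp.pd1, norm_fc_pd1_sq hf hp, aw, Real.rpow_one,
    Real.rpow_one]
  ring

lemma HSq_one_two (hf : Smooth f) (hp : Per f) :
    HSq 1 2 f = (2 * π)⁻¹ ^ 2 *
      (normSq f + normSq (pd1 f) + 2 * normSq (pd2 f) + 2 * normSq (pd2 (pd1 f))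
        + normSq (pd2 (pd2 f)) + normSq (pd2 (pd2 (pd1 f)))) := by
  have e : (2 * π)⁻¹ ^ 2 *
      (normSq f + normSq (pd1 f) + 2 * normSq (pd2 f) + 2 * normSq (pd2 (pd1 f))
        + normSq (pd2 (pd2 f)) + normSq (pd2 (pd2 (pd1 f)))) =
      (2 * π)⁻¹ ^ 2 * normSq f + (2 * π)⁻¹ ^ 2 * normSq (pd1 f)
        + 2 * ((2 * π)⁻¹ ^ 2 * normSq (pd2 f)) + 2 * ((2 * π)⁻¹ ^ 2 * normSq (pd2 (pd1 f)))
        + (2 * π)⁻¹ ^ 2 * normSq (pd2 (pd2 f)) + (2 * π)⁻¹ ^ 2 * normSq (pd2 (pd2 (pd1 f))) := by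
    ring
  rw [e]
  refine HasSum.tsum_eq ?_
  convert (((((hasSum_sq_fc hf.continuous).add (hasSum_sq_fc hf.pd1.continuous)).add
    ((hasSum_sq_fc hf.pd2.continuous).mul_left 2)).add
    ((hasSum_sq_fc hf.pd1.pd2.continuous).mul_left 2)).add
    (hasSum_sq_fc hf.pd2.pd2.continuous)).add
    (hasSum_sq_fc hf.pd1.pd2.pd2.continuous) using 2 with k
  rw [norm_fc_pd2_sq hf.pd2 hp.pd2, norm_fc_pd2_sq hf.pd1.pd2 hp.pd1.pd2, norm_fc_pd2_sq hf hp,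
    norm_fc_pd2_sq hf.pd1 hp.pd1, norm_fc_pd1_sq hf hp, aw, Real.rpow_one, Real.rpow_two]
  ring

end SobolevNorms

/-! ### The energy inequality at a fixed time -/

section Energy

/-- The unnormalised square of the `H^{0,1}` norm. -/
def vertSq (f : ℝ × ℝ → ℝ) : ℝ := normSq f + normSq (pd2 f)

/-- The unnormalised square of the `H^{1,2}` norm. -/
def fullSq (f : ℝ × ℝ → ℝ) : ℝ :=
  normSq f + normSq (pd1 f) + 2 * normSq (pd2 f) + 2 * normSq (pd2 (pd1 f))
    + normSq (pd2 (pd2 f)) + normSq (pd2 (pd2 (pd1 f)))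

/-- The operator `1 - ∂₂²`. -/
def helm (f : ℝ × ℝ → ℝ) : ℝ × ℝ → ℝ := fun x => f x - pd2 (pd2 f) x

variable {f g w Y X1 X2 u1 u2 : ℝ × ℝ → ℝ}

lemma vertSq_nonneg (f : ℝ × ℝ → ℝ) : 0 ≤ vertSq f :=
  add_nonneg (normSq_nonneg _) (normSq_nonneg _)

lemma normSq_le_vertSq (f : ℝ × ℝ → ℝ) : normSq f ≤ vertSq f :=
  le_add_of_nonneg_right (normSq_nonneg _)

lemma normSq_pd2_le_vertSq (f : ℝ × ℝ → ℝ) : normSq (pd2 f) ≤ vertSq f :=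
  le_add_of_nonneg_left (normSq_nonneg _)

lemma fullSq_nonneg (f : ℝ × ℝ → ℝ) : 0 ≤ fullSq f := by
  unfold fullSq
  linarith [normSq_nonneg f, normSq_nonneg (pd1 f), normSq_nonneg (pd2 f),
    normSq_nonneg (pd2 (pd1 f)), normSq_nonneg (pd2 (pd2 f)), normSq_nonneg (pd2 (pd2 (pd1 f)))]

lemma Smooth.helm (hf : Smooth f) : Smooth (helm f) := hf.sub hf.pd2.pd2

lemma Per.helm (hf : Per f) : Per (helm f) := hf.sub hf.pd2.pd2

lemma pd1_helm (hf : Smooth f) : pd1 (helm f) = helm (pd1 f) := by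
  funext x
  unfold Aniso.helm
  rw [pd1_sub hf hf.pd2.pd2, pd1_pd2 hf.pd2, pd1_pd2 hf]

lemma pd2_helm (hf : Smooth f) : pd2 (helm f) = helm (pd2 f) := by
  funext x
  unfold Aniso.helm
  rw [pd2_sub hf hf.pd2.pd2]

lemma tintR_mul_helm (hg : Smooth g) (hf : Smooth f) (hgp : Per g) (hfp : Per f) :
    tintR (fun x => g x * helm f x)
      = tintR (fun x => g x * f x) + tintR (fun x => pd2 g x * pd2 f x) := by
  have h := tintR_mul_pd2 hg hf.pd2 hgp hfp.pd2
  have e : (fun x => g x * helm f x) = fun x => g x * f x - g x * pd2 (pd2 f) x := by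
    funext x
    rw [helm, mul_sub]
  rw [e, tintR_sub (hg.mul hf).continuous (hg.mul hf.pd2.pd2).continuous, h, sub_neg_eq_add]

lemma tintR_mul_self (f : ℝ × ℝ → ℝ) : tintR (fun x => f x * f x) = normSq f := by
  simp only [normSq, sq]

lemma tintR_self_mul_helm (hf : Smooth f) (hfp : Per f) :
    tintR (fun x => f x * helm f x) = vertSq f := by
  rw [tintR_mul_helm hf hf hfp hfp, tintR_mul_self, tintR_mul_self, vertSq]

lemma two_mul_tintR_mul_le (hg : Continuous g) (hf : Continuous f) :
    2 * tintR (fun x => g x * f x) ≤ normSq g + normSq f := by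
  rw [normSq_add_normSq hg hf, ← tintR_const_mul]
  exact tintR_mono (by fun_prop) (by fun_prop) fun x => by nlinarith [sq_nonneg (g x - f x)]

lemma two_mul_tintR_mul_helm_le (hg : Smooth g) (hf : Smooth f) (hgp : Per g) (hfp : Per f) :
    2 * tintR (fun x => g x * helm f x) ≤ vertSq g + vertSq f := by
  rw [tintR_mul_helm hg hf hgp hfp, vertSq, vertSq]
  linarith [two_mul_tintR_mul_le hg.continuous hf.continuous,
    two_mul_tintR_mul_le hg.pd2.continuous hf.pd2.continuous]

/-- The transport term of a divergence-free field is skew-symmetric. -/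
lemma tintR_transport (h1 : Smooth u1) (h2 : Smooth u2) (hY : Smooth Y) (p1 : Per u1)
    (p2 : Per u2) (pY : Per Y) (hdiv : ∀ x, pd1 u1 x + pd2 u2 x = 0) :
    tintR (fun x => (u1 x * pd1 Y x + u2 x * pd2 Y x) * Y x) = 0 := by
  have e1 := tintR_pd1 (h1.mul (hY.mul hY)) (p1.mul (pY.mul pY))
  have e2 := tintR_pd2 (h2.mul (hY.mul hY)) (p2.mul (pY.mul pY))
  have e3 : (fun x => pd1 (fun x => u1 x * (Y x * Y x)) x + pd2 (fun x => u2 x * (Y x * Y x)) x)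
      = fun x => 2 * ((u1 x * pd1 Y x + u2 x * pd2 Y x) * Y x) := by
    funext x
    rw [pd1_mul h1 (hY.mul hY), pd2_mul h2 (hY.mul hY), pd1_mul hY hY, pd2_mul hY hY]
    linear_combination (Y x * Y x) * hdiv x
  have e4 := tintR_add (h1.mul (hY.mul hY)).pd1.continuous (h2.mul (hY.mul hY)).pd2.continuous
  rw [e3, e1, e2, tintR_const_mul] at e4
  linarith

/-- Bound for the linearised convection terms tested against `(1 - ∂₂²) Y`. -/
lemma abs_tintR_convection_le (hX1 : Smooth X1) (hX2 : Smooth X2) (hu1 : Smooth u1)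
    (hu2 : Smooth u2) (hw : Smooth w) (hY : Smooth Y) (pX1 : Per X1) (pX2 : Per X2)
    (pu1 : Per u1) (pu2 : Per u2) (pw : Per w) (pY : Per Y)
    (hdiv : ∀ x, pd1 u1 x + pd2 u2 x = 0) {U M N ε : ℝ} (hε : 0 < ε)
    (mX1 : vertSq X1 + vertSq (pd1 X1) ≤ N) (mX2 : vertSq X2 + vertSq (pd1 X2) ≤ N)
    (mY : vertSq Y + vertSq (pd1 Y) ≤ N) (nX2 : vertSq X2 ≤ M) (nY : vertSq Y ≤ M)
    (bu1 : fullSq u1 ≤ U) (bu2 : fullSq u2 ≤ U) (bw : fullSq w ≤ U) :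
    |tintR (fun x => (X1 x * pd1 w x + X2 x * pd2 w x + (u1 x * pd1 Y x + u2 x * pd2 Y x))
      * helm Y x)| ≤ 8 * (ε * N + U * M / ε) := by
  have hU : 0 ≤ U := (fullSq_nonneg _).trans bw
  have hM : 0 ≤ M := (vertSq_nonneg _).trans nY
  have hN : 0 ≤ N := (add_nonneg (vertSq_nonneg _) (vertSq_nonneg _)).trans mY
  have hG1 := (hX1.mul hw.pd1).add (hX2.mul hw.pd2)
  have hG2 := (hu1.mul hY.pd1).add (hu2.mul hY.pd2)
  have hG := hG1.add hG2
  have pG := ((pX1.mul pw.pd1).add (pX2.mul pw.pd2)).add ((pu1.mul pY.pd1).add (pu2.mul pY.pd2))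
  have pd2G : ∀ x, pd2 (fun x => X1 x * pd1 w x + X2 x * pd2 w x
      + (u1 x * pd1 Y x + u2 x * pd2 Y x)) x
      = (pd2 X1 x * pd1 w x + X1 x * pd2 (pd1 w) x) + (pd2 X2 x * pd2 w x + X2 x * pd2 (pd2 w) x)
        + ((pd2 u1 x * pd1 Y x + u1 x * pd2 (pd1 Y) x)
          + (pd2 u2 x * pd2 Y x + u2 x * pd2 (pd2 Y) x)) := by
    intro x
    rw [pd2_add hG1 hG2, pd2_add (hX1.mul hw.pd1) (hX2.mul hw.pd2),
      pd2_add (hu1.mul hY.pd1) (hu2.mul hY.pd2), pd2_mul hX1 hw.pd1, pd2_mul hX2 hw.pd2,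
      pd2_mul hu1 hY.pd1, pd2_mul hu2 hY.pd2]
  have t1 := tintR_transport hu1 hu2 hY pu1 pu2 pY hdiv
  have t2 := tintR_transport hu1 hu2 hY.pd2 pu1 pu2 pY.pd2 hdiv
  rw [pd1_pd2 hY] at t2
  have cX1 := hX1.continuous
  have cX2 := hX2.continuous
  have cY := hY.continuous
  have cX1' := hX1.pd2.continuous
  have cX2' := hX2.pd2.continuous
  have cu1 := hu1.continuous
  have cu2 := hu2.continuous
  have cu1' := hu1.pd2.continuous
  have cu2' := hu2.pd2.continuous
  have cw1 := hw.pd1.continuous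
  have cw2 := hw.pd2.continuous
  have cw12 := hw.pd1.pd2.continuous
  have cw22 := hw.pd2.pd2.continuous
  have cY1 := hY.pd1.continuous
  have cY2 := hY.pd2.continuous
  have cY12 := hY.pd1.pd2.continuous
  have cY22 := hY.pd2.pd2.continuous
  have e1 : tintR (fun x => (X1 x * pd1 w x + X2 x * pd2 w x + (u1 x * pd1 Y x + u2 x * pd2 Y x))
      * Y x) = tintR (fun x => pd1 w x * X1 x * Y x) + tintR (fun x => pd2 w x * X2 x * Y x) := by
    rw [← add_zero (_ + _), ← t1, ← tintR_add (by fun_prop) (by fun_prop),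
      ← tintR_add (by fun_prop) (by fun_prop)]
    congr 1
    funext x
    ring
  have e2 : tintR (fun x => pd2 (fun x => X1 x * pd1 w x + X2 x * pd2 w x
      + (u1 x * pd1 Y x + u2 x * pd2 Y x)) x * pd2 Y x)
      = tintR (fun x => pd1 w x * pd2 X1 x * pd2 Y x)
        + tintR (fun x => pd2 (pd1 w) x * X1 x * pd2 Y x)
        + tintR (fun x => pd2 w x * pd2 X2 x * pd2 Y x)
        + tintR (fun x => X2 x * pd2 (pd2 w) x * pd2 Y x)
        + tintR (fun x => pd1 Y x * pd2 u1 x * pd2 Y x)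
        + tintR (fun x => pd2 u2 x * pd2 Y x * pd2 Y x) := by
    rw [← add_zero (_ + _), ← t2, ← tintR_add (by fun_prop) (by fun_prop),
      ← tintR_add (by fun_prop) (by fun_prop), ← tintR_add (by fun_prop) (by fun_prop),
      ← tintR_add (by fun_prop) (by fun_prop), ← tintR_add (by fun_prop) (by fun_prop),
      ← tintR_add (by fun_prop) (by fun_prop)]
    congr 1
    funext x
    rw [pd2G]
    ring
  have low : ∀ {f : ℝ × ℝ → ℝ}, vertSq f + vertSq (pd1 f) ≤ N →
      normSq f + normSq (pd1 f) ≤ N := fun h =>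
    (add_le_add (normSq_le_vertSq _) (normSq_le_vertSq _)).trans h
  have high : ∀ {f : ℝ × ℝ → ℝ}, Smooth f → vertSq f + vertSq (pd1 f) ≤ N →
      normSq (pd2 f) + normSq (pd1 (pd2 f)) ≤ N := fun hf h => by
    rw [pd1_pd2 hf]
    exact (add_le_add (normSq_pd2_le_vertSq _) (normSq_pd2_le_vertSq _)).trans h
  have full : ∀ {f : ℝ × ℝ → ℝ}, Smooth f → fullSq f ≤ U →
      normSq (pd1 f) + normSq (pd2 (pd1 f)) ≤ U ∧ normSq (pd2 f) + normSq (pd2 (pd2 f)) ≤ U ∧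
      normSq (pd2 (pd1 f)) + normSq (pd2 (pd2 (pd1 f))) ≤ U ∧
      normSq (pd2 (pd2 f)) + normSq (pd1 (pd2 (pd2 f))) ≤ U ∧
      normSq (pd2 f) + normSq (pd1 (pd2 f)) ≤ U := by
    intro f hf h
    rw [pd1_pd2 hf.pd2, pd1_pd2 hf]
    unfold fullSq at h
    have := normSq_nonneg f
    have := normSq_nonneg (pd1 f)
    have := normSq_nonneg (pd2 f)
    have := normSq_nonneg (pd2 (pd1 f))
    have := normSq_nonneg (pd2 (pd2 f))
    have := normSq_nonneg (pd2 (pd2 (pd1 f)))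
    refine ⟨?_, ?_, ?_, ?_, ?_⟩ <;> linarith
  have main : ∀ {a h k : ℝ × ℝ → ℝ} {p q r : ℝ}, Smooth a → Smooth h → Smooth k →
      normSq a + normSq (pd2 a) ≤ p → normSq h + normSq (pd1 h) ≤ q → normSq k ≤ r →
      p * q * r = U * M * N →
      |tintR (fun x => a x * h x * k x)| ≤ ε * N + U * M / ε := by
    intro a h k p q r ha hh hk h1 h2 h3 h4
    refine abs_tintR_mul_mul_le ha hh hk hε hU hM hN ?_
    rw [← h4]
    have a0 := add_nonneg (normSq_nonneg a) (normSq_nonneg (pd2 a))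
    have b0 := add_nonneg (normSq_nonneg h) (normSq_nonneg (pd1 h))
    exact mul_le_mul (mul_le_mul h1 h2 b0 (a0.trans h1)) h3 (normSq_nonneg k)
      (mul_nonneg (a0.trans h1) (b0.trans h2))
  have kY : normSq Y ≤ M := (normSq_le_vertSq Y).trans nY
  have kY2 : normSq (pd2 Y) ≤ M := (normSq_pd2_le_vertSq Y).trans nY
  have kY2' : normSq (pd2 Y) ≤ N := (normSq_pd2_le_vertSq Y).trans
    ((le_add_of_nonneg_right (vertSq_nonneg _)).trans mY)
  obtain ⟨w1, w2, w3, w4, -⟩ := full hw bw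
  have T1 := main hw.pd1 hX1 hY w1 (low mX1) kY (by ring)
  have T2 := main hw.pd2 hX2 hY w2 (low mX2) kY (by ring)
  have T3 := main hw.pd1 hX1.pd2 hY.pd2 w1 (high hX1 mX1) kY2 (by ring)
  have T4 := main hw.pd1.pd2 hX1 hY.pd2 w3 (low mX1) kY2 (by ring)
  have T5 := main hw.pd2 hX2.pd2 hY.pd2 w2 (high hX2 mX2) kY2 (by ring)
  have T6 := main hX2 hw.pd2.pd2 hY.pd2 nX2 w4 kY2' (by ring)
  have T7 := main hY.pd1 hu1.pd2 hY.pd2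
    ((le_add_of_nonneg_left (vertSq_nonneg Y)).trans mY) (full hu1 bu1).2.2.2.2 kY2 (by ring)
  have T8 := main hu2.pd2 hY.pd2 hY.pd2 (full hu2 bu2).2.1 (high hY mY) kY2 (by ring)
  rw [tintR_mul_helm hG hY pG pY, e1, e2]
  rw [abs_le] at *
  constructor <;> linarith

end Energy

section VectorEnergy

variable {X u f : ℝ × ℝ → ℝ × ℝ}

/-- The operator `1 - ∂₂²` on vector fields. -/
def helmV (X : ℝ × ℝ → ℝ × ℝ) : ℝ × ℝ → ℝ × ℝ :=
  fun x => (helm (comp1 X) x, helm (comp2 X) x)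

lemma SmoothV.comp1 (h : SmoothV X) : Smooth (comp1 X) := ContDiff.fst h

lemma SmoothV.comp2 (h : SmoothV X) : Smooth (comp2 X) := ContDiff.snd h

lemma SmoothV.helmV (h : SmoothV X) : SmoothV (helmV X) :=
  ContDiff.prodMk h.comp1.helm h.comp2.helm

lemma PerV.helmV (h : PerV X) : PerV (helmV X) := ⟨Per.helm h.1, Per.helm h.2⟩

lemma DivFree.helmV (hX : SmoothV X) (h : DivFree X) : DivFree (helmV X) := by
  intro x
  change pd1 (helm (Aniso.comp1 X)) x + pd2 (helm (Aniso.comp2 X)) x = 0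
  have h0 : (fun x => pd1 (Aniso.comp1 X) x + pd2 (Aniso.comp2 X) x) = fun _ => 0 := funext h
  have e2 : pd2 (fun _ : ℝ × ℝ => (0 : ℝ)) = fun _ => 0 := by
    funext x
    simp [pd2]
  have h1 : pd2 (pd2 (fun x => pd1 (Aniso.comp1 X) x + pd2 (Aniso.comp2 X) x)) x = 0 := by
    rw [h0, e2, e2]
  rw [funext (pd2_add hX.comp1.pd1 hX.comp2.pd2), pd2_add hX.comp1.pd1.pd2 hX.comp2.pd2.pd2] at h1
  rw [pd1_helm hX.comp1, pd2_helm hX.comp2, helm, helm]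
  linarith [h x]

lemma ipV_eq (hX : SmoothV X) (hf : SmoothV f) :
    ipV X f = tintR (fun x => comp1 X x * comp1 f x) + tintR (fun x => comp2 X x * comp2 f x) :=
  tintR_add (hX.comp1.mul hf.comp1).continuous (hX.comp2.mul hf.comp2).continuous

lemma SmoothV.pd1V (h : SmoothV X) : SmoothV (pd1V X) :=
  ContDiff.prodMk h.comp1.pd1 h.comp2.pd1

lemma ipV_pd1V_helmV (hX : SmoothV X) (pX : PerV X) :
    ipV (pd1V X) (pd1V (helmV X)) = vertSq (pd1 (comp1 X)) + vertSq (pd1 (comp2 X)) := by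
  rw [ipV_eq hX.pd1V hX.helmV.pd1V]
  change tintR (fun x => pd1 (comp1 X) x * pd1 (helm (comp1 X)) x)
    + tintR (fun x => pd1 (comp2 X) x * pd1 (helm (comp2 X)) x) = _
  rw [pd1_helm hX.comp1, pd1_helm hX.comp2, tintR_self_mul_helm hX.comp1.pd1 (Per.pd1 pX.1),
    tintR_self_mul_helm hX.comp2.pd1 (Per.pd1 pX.2)]

lemma two_mul_ipV_helmV_le (hX : SmoothV X) (pX : PerV X) (hf : SmoothV f) (pf : PerV f) :
    2 * ipV f (helmV X) ≤
      vertSq (comp1 f) + vertSq (comp2 f) + (vertSq (comp1 X) + vertSq (comp2 X)) := by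
  rw [ipV_eq hf hX.helmV]
  have h1 := two_mul_tintR_mul_helm_le hf.comp1 hX.comp1 pf.1 pX.1
  have h2 := two_mul_tintR_mul_helm_le hf.comp2 hX.comp2 pf.2 pX.2
  change 2 * (tintR (fun x => comp1 f x * helm (comp1 X) x)
    + tintR (fun x => comp2 f x * helm (comp2 X) x)) ≤ _
  linarith

lemma SmoothV.advect (hu : SmoothV u) (hX : SmoothV X) : SmoothV (advect u X) :=
  ContDiff.prodMk ((hu.comp1.mul hX.comp1.pd1).add (hu.comp2.mul hX.comp1.pd2))
    ((hu.comp1.mul hX.comp2.pd1).add (hu.comp2.mul hX.comp2.pd2))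

lemma b3_add_b3_helmV (hX : SmoothV X) (hu : SmoothV u) :
    b3 X u (helmV X) + b3 u X (helmV X) =
      tintR (fun x => (comp1 X x * pd1 (comp1 u) x + comp2 X x * pd2 (comp1 u) x
        + (comp1 u x * pd1 (comp1 X) x + comp2 u x * pd2 (comp1 X) x)) * helm (comp1 X) x)
      + tintR (fun x => (comp1 X x * pd1 (comp2 u) x + comp2 X x * pd2 (comp2 u) x
        + (comp1 u x * pd1 (comp2 X) x + comp2 u x * pd2 (comp2 X) x)) * helm (comp2 X) x) := by
  rw [b3, b3, ipV_eq (hX.advect hu) hX.helmV, ipV_eq (hu.advect hX) hX.helmV]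
  rw [add_add_add_comm,
    ← tintR_add ((hX.advect hu).comp1.mul hX.helmV.comp1).continuous
      ((hu.advect hX).comp1.mul hX.helmV.comp1).continuous,
    ← tintR_add ((hX.advect hu).comp2.mul hX.helmV.comp2).continuous
      ((hu.advect hX).comp2.mul hX.helmV.comp2).continuous]
  congr 2 <;> funext x <;> rw [← add_mul] <;> rfl

/-- The energy inequality obtained by testing the equation with `(1 - ∂₂²) X`. -/
lemma two_mul_weak_rhs_le (hX : SmoothV X) (pX : PerV X) (hu : SmoothV u) (pu : PerV u)
    (hdiv : DivFree u) (hf : SmoothV f) (pf : PerV f) :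
    2 * (-(ipV (pd1V X) (pd1V (helmV X))) - b3 X u (helmV X) - b3 u X (helmV X)
      + ipV f (helmV X)) ≤
      -(vertSq (pd1 (comp1 X)) + vertSq (pd1 (comp2 X)))
      + (2 + 1024 * (fullSq (comp1 u) + fullSq (comp2 u)))
        * (vertSq (comp1 X) + vertSq (comp2 X))
      + (vertSq (comp1 f) + vertSq (comp2 f)) := by
  have hb := b3_add_b3_helmV hX hu
  have hF := two_mul_ipV_helmV_le hX pX hf pf
  rw [ipV_pd1V_helmV hX pX]
  set E1 := vertSq (comp1 X) with hE1
  set E2 := vertSq (comp2 X) with hE2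
  set D1 := vertSq (pd1 (comp1 X)) with hD1
  set D2 := vertSq (pd1 (comp2 X)) with hD2
  set U1 := fullSq (comp1 u) with hU1
  set U2 := fullSq (comp2 u) with hU2
  have nE1 : 0 ≤ E1 := vertSq_nonneg _
  have nE2 : 0 ≤ E2 := vertSq_nonneg _
  have nD1 : 0 ≤ D1 := vertSq_nonneg _
  have nD2 : 0 ≤ D2 := vertSq_nonneg _
  have nU1 : 0 ≤ U1 := fullSq_nonneg _
  have nU2 : 0 ≤ U2 := fullSq_nonneg _
  have T1 := abs_tintR_convection_le hX.comp1 hX.comp2 hu.comp1 hu.comp2 hu.comp1 hX.comp1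
    pX.1 pX.2 pu.1 pu.2 pu.1 pX.1 hdiv (U := U1 + U2) (M := E1 + E2) (N := E1 + E2 + (D1 + D2))
    (ε := 1 / 32) (by norm_num) (by linarith) (by linarith) (by linarith) (by linarith)
    (by linarith) (by linarith) (by linarith) (by linarith)
  have T2 := abs_tintR_convection_le hX.comp1 hX.comp2 hu.comp1 hu.comp2 hu.comp2 hX.comp2
    pX.1 pX.2 pu.1 pu.2 pu.2 pX.2 hdiv (U := U1 + U2) (M := E1 + E2) (N := E1 + E2 + (D1 + D2))
    (ε := 1 / 32) (by norm_num) (by linarith) (by linarith) (by linarith) (by linarith)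
    (by linarith) (by linarith) (by linarith) (by linarith)
  have T1' := neg_le_of_abs_le T1
  have T2' := neg_le_of_abs_le T2
  linarith

end VectorEnergy

/-! ### Grönwall's argument -/

section Gronwall

lemma gronwall_dissipation {E E' D F a : ℝ → ℝ} {T : ℝ} (hT : 0 ≤ T)
    (hE : ∀ t ∈ Icc 0 T, HasDerivAt E (E' t) t) (hE0 : E 0 = 0)
    (hle : ∀ t ∈ Icc 0 T, E' t ≤ -(D t) + a t * E t + F t)
    (cD : Continuous D) (cF : Continuous F) (ca : Continuous a)
    (nE : ∀ t, 0 ≤ E t) (nD : ∀ t, 0 ≤ D t) (nF : ∀ t, 0 ≤ F t) (na : ∀ t, 0 ≤ a t) :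
    (∀ t ∈ Icc 0 T, E t ≤ Real.exp (∫ s in (0 : ℝ)..T, a s) * ∫ s in (0 : ℝ)..T, F s) ∧
      ∫ s in (0 : ℝ)..T, D s ≤ Real.exp (∫ s in (0 : ℝ)..T, a s) * ∫ s in (0 : ℝ)..T, F s := by
  set A : ℝ → ℝ := fun t => ∫ s in (0 : ℝ)..t, a s with hA
  have dA : ∀ t, HasDerivAt A (a t) t := fun t => ca.integral_hasStrictDerivAt 0 t |>.hasDerivAt
  have cA : Continuous A := continuous_iff_continuousAt.2 fun t => (dA t).continuousAt
  have cw : Continuous fun t => Real.exp (-A t) * D t := by fun_prop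
  set y : ℝ → ℝ := fun t => Real.exp (-A t) * E t
    + (∫ s in (0 : ℝ)..t, Real.exp (-A s) * D s) - ∫ s in (0 : ℝ)..t, F s with hy
  have dy : ∀ t ∈ Icc 0 T, HasDerivAt y
      (Real.exp (-A t) * (-(a t)) * E t + Real.exp (-A t) * E' t + Real.exp (-A t) * D t - F t)
      t := fun t ht =>
    (((dA t).fun_neg.exp.fun_mul (hE t ht)).fun_add
      (cw.integral_hasStrictDerivAt 0 t).hasDerivAt).fun_sub
      (cF.integral_hasStrictDerivAt 0 t).hasDerivAt
  have nA : ∀ t ∈ Icc 0 T, 0 ≤ A t := fun t ht =>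
    intervalIntegral.integral_nonneg ht.1 fun s _ => na s
  have mA : ∀ t ∈ Icc 0 T, A t ≤ A T := fun t ht =>
    intervalIntegral.integral_mono_interval le_rfl ht.1 ht.2 (ae_of_all _ na)
      (ca.intervalIntegrable _ _)
  have ya : AntitoneOn y (Icc 0 T) := by
    refine antitoneOn_of_hasDerivWithinAt_nonpos (convex_Icc 0 T)
      (fun t ht => (dy t ht).continuousAt.continuousWithinAt)
      (fun t ht => (dy t (interior_subset ht)).hasDerivWithinAt) fun t ht => ?_
    have ht' := interior_subset ht
    have h1 : Real.exp (-A t) ≤ 1 := Real.exp_le_one_iff.2 (neg_nonpos.2 (nA t ht'))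
    have h2 := mul_le_mul_of_nonneg_left (hle t ht') (Real.exp_pos (-A t)).le
    have h3 := mul_le_mul_of_nonneg_right h1 (nF t)
    nlinarith
  have y0 : y 0 = 0 := by simp [hy, hE0]
  have main : ∀ t ∈ Icc 0 T, Real.exp (-A t) * E t
      + (∫ s in (0 : ℝ)..t, Real.exp (-A s) * D s) ≤ ∫ s in (0 : ℝ)..T, F s := by
    intro t ht
    have h1 := ya ⟨le_rfl, hT⟩ ht ht.1
    have h2 : ∫ s in (0 : ℝ)..t, F s ≤ ∫ s in (0 : ℝ)..T, F s :=
      intervalIntegral.integral_mono_interval le_rfl ht.1 ht.2 (ae_of_all _ nF)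
        (cF.intervalIntegrable _ _)
    rw [y0] at h1
    simp only [hy] at h1
    linarith
  have undo : ∀ {b c : ℝ}, Real.exp (-A T) * b ≤ c → b ≤ Real.exp (A T) * c := by
    intro b c h
    have := mul_le_mul_of_nonneg_left h (Real.exp_pos (A T)).le
    rwa [← mul_assoc, ← Real.exp_add, add_neg_cancel, Real.exp_zero, one_mul] at this
  have decay : ∀ t ∈ Icc 0 T, Real.exp (-A T) ≤ Real.exp (-A t) := fun t ht =>
    Real.exp_le_exp.2 (neg_le_neg (mA t ht))
  refine ⟨fun t ht => undo ?_, undo ?_⟩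
  · have h1 := main t ht
    have h2 : 0 ≤ ∫ s in (0 : ℝ)..t, Real.exp (-A s) * D s :=
      intervalIntegral.integral_nonneg ht.1 fun s _ => mul_nonneg (Real.exp_pos _).le (nD s)
    have h3 := mul_le_mul_of_nonneg_right (decay t ht) (nE t)
    linarith
  · have h1 := main T ⟨hT, le_rfl⟩
    have h2 : 0 ≤ Real.exp (-A T) * E T := mul_nonneg (Real.exp_pos _).le (nE T)
    rw [← intervalIntegral.integral_const_mul]
    have h3 : ∫ s in (0 : ℝ)..T, Real.exp (-A T) * D s ≤ ∫ s in (0 : ℝ)..T, Real.exp (-A s) * D s :=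
      intervalIntegral.integral_mono_on hT (Continuous.intervalIntegrable (by fun_prop) _ _)
        (cw.intervalIntegrable _ _) fun s hs =>
          mul_le_mul_of_nonneg_right (decay s hs) (nD s)
    linarith

end Gronwall

section Assembly

variable {F : ℝ → ℝ × ℝ → ℝ} {V : ℝ → ℝ × ℝ → ℝ × ℝ}

lemma JointSmooth.continuous_normSq (hF : JointSmooth F) : Continuous fun t => normSq (F t) := by
  simp_rw [← tintR_mul_self]
  exact (hF.mul hF).continuous_tintR

lemma JointSmooth.continuous_vertSq (hF : JointSmooth F) : Continuous fun t => vertSq (F t) :=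
  hF.continuous_normSq.add hF.pd2.continuous_normSq

lemma JointSmooth.continuous_fullSq (hF : JointSmooth F) : Continuous fun t => fullSq (F t) := by
  have h0 := hF.continuous_normSq
  have h1 := hF.pd1.continuous_normSq
  have h2 := hF.pd2.continuous_normSq
  have h3 := hF.pd1.pd2.continuous_normSq
  have h4 := hF.pd2.pd2.continuous_normSq
  have h5 := hF.pd1.pd2.pd2.continuous_normSq
  unfold fullSq
  fun_prop

lemma HNV_zero_one_sq {X : ℝ × ℝ → ℝ × ℝ} (hX : SmoothV X) (pX : PerV X) :
    HNV 0 1 X ^ 2 = (2 * π)⁻¹ ^ 2 * (vertSq (comp1 X) + vertSq (comp2 X)) := by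
  have h : HSq 0 1 (comp1 X) + HSq 0 1 (comp2 X)
      = (2 * π)⁻¹ ^ 2 * (vertSq (comp1 X) + vertSq (comp2 X)) := by
    rw [HSq_zero_one hX.comp1 pX.1, HSq_zero_one hX.comp2 pX.2, vertSq, vertSq]
    ring
  have n1 := vertSq_nonneg (comp1 X)
  have n2 := vertSq_nonneg (comp2 X)
  rw [HNV, h, Real.sq_sqrt (by positivity)]

lemma HNV_one_one_sq {X : ℝ × ℝ → ℝ × ℝ} (hX : SmoothV X) (pX : PerV X) :
    HNV 1 1 X ^ 2 = (2 * π)⁻¹ ^ 2 * (vertSq (comp1 X) + vertSq (comp2 X)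
      + (vertSq (pd1 (comp1 X)) + vertSq (pd1 (comp2 X)))) := by
  have h : HSq 1 1 (comp1 X) + HSq 1 1 (comp2 X)
      = (2 * π)⁻¹ ^ 2 * (vertSq (comp1 X) + vertSq (comp2 X)
      + (vertSq (pd1 (comp1 X)) + vertSq (pd1 (comp2 X)))) := by
    rw [HSq_one_one hX.comp1 pX.1, HSq_one_one hX.comp2 pX.2, vertSq, vertSq, vertSq, vertSq]
    ring
  have n1 := vertSq_nonneg (comp1 X)
  have n2 := vertSq_nonneg (comp2 X)
  have n3 := vertSq_nonneg (pd1 (comp1 X))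
  have n4 := vertSq_nonneg (pd1 (comp2 X))
  rw [HNV, h, Real.sq_sqrt (by positivity)]

lemma HNV_one_two_sq {X : ℝ × ℝ → ℝ × ℝ} (hX : SmoothV X) (pX : PerV X) :
    HNV 1 2 X ^ 2 = (2 * π)⁻¹ ^ 2 * (fullSq (comp1 X) + fullSq (comp2 X)) := by
  have h : HSq 1 2 (comp1 X) + HSq 1 2 (comp2 X)
      = (2 * π)⁻¹ ^ 2 * (fullSq (comp1 X) + fullSq (comp2 X)) := by
    rw [HSq_one_two hX.comp1 pX.1, HSq_one_two hX.comp2 pX.2, fullSq, fullSq]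
    ring
  have n1 := fullSq_nonneg (comp1 X)
  have n2 := fullSq_nonneg (comp2 X)
  rw [HNV, h, Real.sq_sqrt (by positivity)]

/-- Differentiation of the `H^{0,1}` energy, given the time derivative of `X` tested against the
frozen field `(1 - ∂₂²) X(t)`. -/
lemma hasDerivAt_energy (hV1 : JointSmooth fun t => comp1 (V t))
    (hV2 : JointSmooth fun t => comp2 (V t)) (sV : ∀ t, SmoothV (V t)) (pV : ∀ t, PerV (V t))
    {t b : ℝ} (h : HasDerivAt (fun s => ipV (V s) (helmV (V t))) b t) :
    HasDerivAt (fun s => vertSq (comp1 (V s)) + vertSq (comp2 (V s))) (2 * b) t := by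
  have hH1 : JointSmooth fun t => helm (comp1 (V t)) := hV1.sub hV1.pd2.pd2
  have hH2 : JointSmooth fun t => helm (comp2 (V t)) := hV2.sub hV2.pd2.pd2
  have e : ∀ s r, ipV (V s) (helmV (V r)) = tintR (fun x => comp1 (V s) x * helm (comp1 (V r)) x)
      + tintR (fun x => comp2 (V s) x * helm (comp2 (V r)) x) :=
    fun s r => ipV_eq (sV s) (sV r).helmV
  have key := hasDerivAt_diagonal (B := fun p : ℝ × ℝ => ipV (V p.1) (helmV (V p.2))) (t := t)
    (b := b) ?_ ?_ h
  · convert key using 1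
    funext s
    rw [e, tintR_self_mul_helm (sV s).comp1 (pV s).1, tintR_self_mul_helm (sV s).comp2 (pV s).2]
  · simp_rw [e]
    exact (hV1.differentiable_pairing hH1).add (hV2.differentiable_pairing hH2)
  · intro s r
    have sym : ∀ {f g : ℝ × ℝ → ℝ}, Smooth f → Smooth g → Per f → Per g →
        tintR (fun x => f x * helm g x) = tintR (fun x => g x * helm f x) := by
      intro f g hf hg pf pg
      rw [tintR_mul_helm hf hg pf pg, tintR_mul_helm hg hf pg pf]
      simp only [mul_comm]
    simp only [e]
    rw [sym (sV s).comp1 (sV r).comp1 (pV s).1 (pV r).1,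
      sym (sV s).comp2 (sV r).comp2 (pV s).2 (pV r).2]

end Assembly

lemma two_add_mul_le_mul_exp {K I T G M : ℝ} (hK : 2 ≤ K) (hT : 0 ≤ T) (hTI : T ≤ I)
    (hG : 0 ≤ G) (hM0 : 0 ≤ M) (hM : M ≤ Real.exp (K * I)) :
    (2 + T) * (M * G) ≤ (K + 1) * G * Real.exp ((K + 1) * I) := by
  have h : 2 + T ≤ (K + 1) * Real.exp I := by
    nlinarith [Real.add_one_le_exp I]
  calc (2 + T) * (M * G) ≤ ((K + 1) * Real.exp I) * (Real.exp (K * I) * G) := by gcongr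
    _ = (K + 1) * G * Real.exp ((K + 1) * I) := by
      rw [show (K + 1) * I = K * I + I by ring, Real.exp_add]; ring

/-- The components of a smooth time-dependent vector field are jointly smooth. -/
lemma JointSmooth.comp1 {V : ℝ → ℝ × ℝ → ℝ × ℝ}
    (hV : ContDiff ℝ (⊤ : ℕ∞) (fun p : ℝ × (ℝ × ℝ) => V p.1 p.2)) :
    JointSmooth fun t => Aniso.comp1 (V t) := hV.fst

lemma JointSmooth.comp2 {V : ℝ → ℝ × ℝ → ℝ × ℝ}
    (hV : ContDiff ℝ (⊤ : ℕ∞) (fun p : ℝ × (ℝ × ℝ) => V p.1 p.2)) :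
    JointSmooth fun t => Aniso.comp2 (V t) := hV.snd

lemma smoothV_slice {V : ℝ → ℝ × ℝ → ℝ × ℝ}
    (hV : ContDiff ℝ (⊤ : ℕ∞) (fun p : ℝ × (ℝ × ℝ) => V p.1 p.2)) (t : ℝ) : SmoothV (V t) :=
  hV.comp (contDiff_const.prodMk contDiff_id)

lemma vertSq_zero : vertSq (fun _ => 0) = 0 := by
  simp [vertSq, normSq, pd2, tintR]

/-- a priori `H^{0,1}`–`H^{1,1}` estimate for the forced
linearized anisotropic Navier–Stokes equation along `u⁰`, with zero initial data. -/
theorem forced_linearized_estimate :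
    ∃ C > 0, ∀ T : ℝ, 0 < T → ∀ u0 f X : ℝ → ℝ × ℝ → ℝ × ℝ, ∀ g : ℝ → ℝ,
      ContDiff ℝ (⊤ : ℕ∞) (fun p : ℝ × (ℝ × ℝ) => u0 p.1 p.2) →
      (∀ t, PerV (u0 t)) → (∀ t ∈ Set.Icc (0 : ℝ) T, DivFree (u0 t)) →
      ContDiff ℝ (⊤ : ℕ∞) (fun p : ℝ × (ℝ × ℝ) => f p.1 p.2) →
      (∀ t, PerV (f t)) → (∀ t ∈ Set.Icc (0 : ℝ) T, DivFree (f t)) →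
      IntervalIntegrable (fun t => g t ^ 2) MeasureTheory.volume 0 T →
      (∀ t ∈ Set.Icc (0 : ℝ) T, HNV 0 1 (f t) ≤ g t) →
      ContDiff ℝ (⊤ : ℕ∞) (fun p : ℝ × (ℝ × ℝ) => X p.1 p.2) →
      (∀ t, PerV (X t)) → (∀ t ∈ Set.Icc (0 : ℝ) T, DivFree (X t)) →
      (∀ x, X 0 x = 0) →
      (∀ φ : ℝ × ℝ → ℝ × ℝ, SmoothV φ → PerV φ → DivFree φ →
        ∀ t ∈ Set.Icc (0 : ℝ) T,
          HasDerivAt (fun τ => ipV (X τ) φ)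
            (-(ipV (pd1V (X t)) (pd1V φ)) - b3 (X t) (u0 t) φ - b3 (u0 t) (X t) φ +
              ipV (f t) φ) t) →
      (⨆ t : Set.Icc (0 : ℝ) T, HNV 0 1 (X ↑t) ^ 2) +
          (∫ t in (0 : ℝ)..T, HNV 1 1 (X t) ^ 2) ≤
        C * (∫ t in (0 : ℝ)..T, g t ^ 2) *
          Real.exp (C * ∫ t in (0 : ℝ)..T, (1 + HNV 1 2 (u0 t) ^ 2)) := by
  set c : ℝ := (2 * π)⁻¹ ^ 2 with hc
  have hcpos : 0 < c := by positivity
  have hcinv : 9 ≤ c⁻¹ := by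
    have h : c⁻¹ = (2 * π) ^ 2 := by rw [hc, inv_pow, inv_inv]
    rw [h]
    nlinarith [Real.pi_gt_three]
  refine ⟨1024 * c⁻¹ + 1, by positivity, ?_⟩
  intro T hT u0 f X g su pu du sf pf _ ig hg sX pX dX hX0 hX
  have hu1 := JointSmooth.comp1 su
  have hu2 := JointSmooth.comp2 su
  have hf1 := JointSmooth.comp1 sf
  have hf2 := JointSmooth.comp2 sf
  have hX1 := JointSmooth.comp1 sX
  have hX2 := JointSmooth.comp2 sX
  have su' := smoothV_slice su
  have sf' := smoothV_slice sf
  have sX' := smoothV_slice sX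
  set E : ℝ → ℝ := fun t => vertSq (comp1 (X t)) + vertSq (comp2 (X t)) with hE
  set D : ℝ → ℝ := fun t => vertSq (pd1 (comp1 (X t))) + vertSq (pd1 (comp2 (X t))) with hD
  set F : ℝ → ℝ := fun t => vertSq (comp1 (f t)) + vertSq (comp2 (f t)) with hF
  set A : ℝ → ℝ := fun t => fullSq (comp1 (u0 t)) + fullSq (comp2 (u0 t)) with hA
  have cE : Continuous E := hX1.continuous_vertSq.add hX2.continuous_vertSq
  have cD : Continuous D := hX1.pd1.continuous_vertSq.add hX2.pd1.continuous_vertSq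
  have cF : Continuous F := hf1.continuous_vertSq.add hf2.continuous_vertSq
  have cA : Continuous A := hu1.continuous_fullSq.add hu2.continuous_fullSq
  have nE : ∀ t, 0 ≤ E t := fun t => add_nonneg (vertSq_nonneg _) (vertSq_nonneg _)
  have nD : ∀ t, 0 ≤ D t := fun t => add_nonneg (vertSq_nonneg _) (vertSq_nonneg _)
  have nF : ∀ t, 0 ≤ F t := fun t => add_nonneg (vertSq_nonneg _) (vertSq_nonneg _)
  have nA : ∀ t, 0 ≤ A t := fun t => add_nonneg (fullSq_nonneg _) (fullSq_nonneg _)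
  have hE0 : E 0 = 0 := by
    have h1 : comp1 (X 0) = fun _ => 0 := by funext x; simp [comp1, hX0 x]
    have h2 : comp2 (X 0) = fun _ => 0 := by funext x; simp [comp2, hX0 x]
    simp only [hE, h1, h2, vertSq_zero, add_zero]
  obtain ⟨hsup, hdiss⟩ := gronwall_dissipation (E := E) (D := D) (F := F)
    (a := fun t => 2 + 1024 * A t) hT.le
    (fun t ht => hasDerivAt_energy hX1 hX2 sX' pX
      (hX _ (sX' t).helmV (pX t).helmV ((dX t ht).helmV (sX' t)) t ht)) hE0
    (fun t ht => two_mul_weak_rhs_le (sX' t) (pX t) (su' t) (pu t) (du t ht) (sf' t) (pf t))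
    cD cF (by fun_prop) nE nD nF (fun t => by have := nA t; positivity)
  have e01 : ∀ t, HNV 0 1 (X t) ^ 2 = c * E t := fun t => HNV_zero_one_sq (sX' t) (pX t)
  have e11 : ∀ t, HNV 1 1 (X t) ^ 2 = c * (E t + D t) := fun t => HNV_one_one_sq (sX' t) (pX t)
  have e12 : ∀ t, HNV 1 2 (u0 t) ^ 2 = c * A t := fun t => HNV_one_two_sq (su' t) (pu t)
  simp only [e01, e11, e12]
  set G := ∫ t in (0 : ℝ)..T, g t ^ 2 with hGdef
  set I := ∫ t in (0 : ℝ)..T, (1 + c * A t) with hIdef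
  set M := Real.exp (∫ s in (0 : ℝ)..T, (2 + 1024 * A s)) with hM
  have hMpos : 0 < M := Real.exp_pos _
  have hG : 0 ≤ G := intervalIntegral.integral_nonneg hT.le fun t _ => sq_nonneg _
  have hTI : T ≤ I := by
    have : ∫ t in (0 : ℝ)..T, (1 : ℝ) ≤ I :=
      intervalIntegral.integral_mono_on hT.le (by simp)
        ((by fun_prop : Continuous _).intervalIntegrable _ _)
        fun t _ => le_add_of_nonneg_right (mul_nonneg hcpos.le (nA t))
    simpa using this
  have hFG : c * (∫ t in (0 : ℝ)..T, F t) ≤ G := by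
    rw [← intervalIntegral.integral_const_mul]
    refine intervalIntegral.integral_mono_on hT.le
      ((by fun_prop : Continuous _).intervalIntegrable _ _) ig fun t ht => ?_
    have h : HNV 0 1 (f t) ^ 2 = c * F t := HNV_zero_one_sq (sf' t) (pf t)
    rw [← h]
    exact pow_le_pow_left₀ (Real.sqrt_nonneg _) (hg t ht) 2
  have hexp : M ≤ Real.exp (1024 * c⁻¹ * I) := by
    refine Real.exp_le_exp.2 ?_
    rw [hIdef, ← intervalIntegral.integral_const_mul]
    refine intervalIntegral.integral_mono_on hT.le
      ((by fun_prop : Continuous _).intervalIntegrable _ _)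
      ((by fun_prop : Continuous _).intervalIntegrable _ _) fun t _ => ?_
    have : 1024 * c⁻¹ * (1 + c * A t) = 1024 * c⁻¹ + 1024 * A t := by field_simp
    rw [this]
    linarith
  have hbd : ∀ y, y ≤ M * ∫ t in (0 : ℝ)..T, F t → c * y ≤ M * G := fun y hy => by
    calc c * y ≤ c * (M * ∫ t in (0 : ℝ)..T, F t) := mul_le_mul_of_nonneg_left hy hcpos.le
      _ = M * (c * ∫ t in (0 : ℝ)..T, F t) := by ring
      _ ≤ M * G := mul_le_mul_of_nonneg_left hFG hMpos.le
  have s1 : (⨆ t : Set.Icc (0 : ℝ) T, c * E t) ≤ M * G := by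
    have : Nonempty (Set.Icc (0 : ℝ) T) := ⟨⟨0, le_rfl, hT.le⟩⟩
    exact ciSup_le fun t => hbd _ (hsup t t.2)
  have s2 : ∫ t in (0 : ℝ)..T, c * (E t + D t) ≤ T * (M * G) + M * G := by
    have h1 : ∫ t in (0 : ℝ)..T, c * E t ≤ T * (M * G) := by
      have : ∫ t in (0 : ℝ)..T, c * E t ≤ ∫ t in (0 : ℝ)..T, M * G :=
        intervalIntegral.integral_mono_on hT.le
          ((by fun_prop : Continuous _).intervalIntegrable _ _) (by simp)
          fun t ht => hbd _ (hsup t ht)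
      rwa [intervalIntegral.integral_const, sub_zero, smul_eq_mul] at this
    have h2 : ∫ t in (0 : ℝ)..T, c * D t ≤ M * G := by
      rw [intervalIntegral.integral_const_mul]
      exact hbd _ hdiss
    simp only [mul_add]
    rw [intervalIntegral.integral_add ((by fun_prop : Continuous _).intervalIntegrable _ _)
      ((by fun_prop : Continuous _).intervalIntegrable _ _)]
    exact add_le_add h1 h2
  have hfin := two_add_mul_le_mul_exp (K := 1024 * c⁻¹) (by linarith) hT.le hTI hG hMpos.le hexp
  linarith

end Aniso
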